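/- Let f be a pseudo-polynomial. Then there exist η > 0, C > 0 and N₀ ∈ ℕ, depending only on f, such that for every real number ξ and every integer N ≥ N₀ one has min_{1 ≤ n ≤ N} ‖ξ⌊f(n)⌋‖ ≤ C·N^{−η}. -/

import Mathlib

/-- Distance from a real number to the nearest integer. -/
noncomputable def nearestIntDist (x : ℝ) : ℝ := |x - round x|

/-- A pseudo-polynomial: `f(x) = α₁ x^{θ₁} + ⋯ + α_d x^{θ_d}` with all `αᵢ > 0`,
`1 ≤ θ₁ < ⋯ < θ_d`, and at least one `θⱼ` not an integer. -/
def IsPseudoPoly (f : ℝ → ℝ) : Prop :=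
  ∃ (d : ℕ) (α θ : Fin (d + 1) → ℝ),
    (∀ i, 0 < α i) ∧ (1 ≤ θ 0) ∧ StrictMono θ ∧
    (∃ i, ∀ m : ℤ, θ i ≠ (m : ℝ)) ∧
    ∀ x : ℝ, f x = ∑ i, α i * x ^ (θ i)

/-! ### Distance to the nearest integer -/

lemma nearestIntDist_nonneg (x : ℝ) : 0 ≤ nearestIntDist x := abs_nonneg _

lemma nearestIntDist_le (x : ℝ) (k : ℤ) : nearestIntDist x ≤ |x - k| := round_le x k

lemma nearestIntDist_le_half (x : ℝ) : nearestIntDist x ≤ 1 / 2 := abs_sub_round x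

lemma nearestIntDist_le_one (x : ℝ) : nearestIntDist x ≤ 1 :=
  (nearestIntDist_le_half x).trans (by norm_num)

lemma nearestIntDist_le_abs (x : ℝ) : nearestIntDist x ≤ |x| := by
  simpa using nearestIntDist_le x 0

lemma nearestIntDist_add_le (x y : ℝ) :
    nearestIntDist (x + y) ≤ nearestIntDist x + nearestIntDist y := by
  refine (nearestIntDist_le (x + y) (round x + round y)).trans ?_
  rw [show x + y - ((round x + round y : ℤ) : ℝ) = (x - round x) + (y - round y) by push_cast; ring]
  exact abs_add_le _ _

lemma nearestIntDist_intCast_mul_le (k : ℤ) (x : ℝ) :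
    nearestIntDist (k * x) ≤ |(k : ℝ)| * nearestIntDist x := by
  refine (nearestIntDist_le _ (k * round x)).trans ?_
  rw [show (k : ℝ) * x - ((k * round x : ℤ) : ℝ) = k * (x - round x) by push_cast; ring, abs_mul]
  rfl

lemma nearestIntDist_natCast_mul_le (k : ℕ) (x : ℝ) :
    nearestIntDist (k * x) ≤ k * nearestIntDist x := by
  simpa using nearestIntDist_intCast_mul_le k x

lemma nearestIntDist_add_intCast (x : ℝ) (k : ℤ) :
    nearestIntDist (x + k) = nearestIntDist x := by
  unfold nearestIntDist
  rw [round_add_intCast]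
  push_cast
  congr 1
  ring

lemma nearestIntDist_sum_le {ι : Type*} (s : Finset ι) (g : ι → ℝ) :
    nearestIntDist (∑ i ∈ s, g i) ≤ ∑ i ∈ s, nearestIntDist (g i) := by
  classical
  induction s using Finset.induction_on with
  | empty => simp [nearestIntDist]
  | insert a s ha ih =>
    rw [Finset.sum_insert ha, Finset.sum_insert ha]
    exact (nearestIntDist_add_le _ _).trans (by gcongr)

/-- If many multiples `β h`, `h ≤ N`, are close to integers, then `β` is close to a rational number
with small denominator. -/
lemma exists_natCast_mul_close_of_many_close {β ε δ : ℝ} {N : ℕ} {A : Finset ℕ} (hN : 1 ≤ N)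
    (hA : ∀ h ∈ A, 1 ≤ h ∧ h ≤ N) (hδ : 0 < δ) (hcard : δ * N ≤ A.card) (_hε : 0 ≤ ε)
    (hclose : ∀ h ∈ A, nearestIntDist (β * h) ≤ ε) (hsmall : 20 * ε < δ) :
    ∃ q : ℕ, 1 ≤ q ∧ q * δ ≤ 1 ∧ nearestIntDist (q * β) * (δ ^ 2 * N) ≤ ε := by
  obtain ⟨r, hr, hrden⟩ := Real.exists_rat_abs_sub_le_and_den_le β (n := 4 * N) (by omega)
  set q := r.den with hq
  have hq0 : 0 < q := r.den_pos
  have hqR : (0 : ℝ) < q := by exact_mod_cast hq0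
  have hNR : (1 : ℝ) ≤ N := by exact_mod_cast hN
  have hrq : (r : ℝ) * q = r.num := by exact_mod_cast Rat.mul_den_eq_num r
  set θ := β - r with hθ
  have hθN : |θ| * q * N ≤ 1 / 4 := by
    have h1 : |θ| * q ≤ 1 / (4 * N) := by
      calc |θ| * q ≤ 1 / ((((4 * N : ℕ) : ℝ) + 1) * q) * q := by gcongr
        _ = 1 / (((4 * N : ℕ) : ℝ) + 1) := by field_simp
        _ ≤ 1 / (4 * N) := by push_cast; gcongr; linarith
    calc |θ| * q * N ≤ 1 / (4 * N) * N := by gcongr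
      _ = 1 / 4 := by field_simp
  let b : ℕ → ℤ := fun h => r.num * h - q * round (β * h)
  have hb : ∀ h ∈ A, |(b h : ℝ)| ≤ q * ε + 1 / 4 := by
    intro h hh
    have e1 : (b h : ℝ) = q * (β * h - round (β * h)) - q * θ * h := by
      simp only [b]; push_cast; rw [← hrq, hθ]; ring
    rw [e1]
    have h2 : |q * (β * h - round (β * h))| ≤ q * ε := by
      rw [abs_mul, abs_of_pos hqR]; gcongr; exact hclose h hh
    have h3 : |q * θ * h| ≤ 1 / 4 := by
      rw [abs_mul, abs_mul, abs_of_pos hqR, Nat.abs_cast]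
      refine le_trans ?_ hθN
      rw [mul_comm (q : ℝ)]
      have : (h : ℝ) ≤ N := by exact_mod_cast (hA h hh).2
      gcongr
    exact (abs_sub _ _).trans (by linarith)
  have hcop : ∀ x : ℤ, (q : ℤ) ∣ r.num * x → (q : ℤ) ∣ x := by
    intro x hx
    have : IsCoprime (q : ℤ) r.num := by
      rw [Int.isCoprime_iff_nat_coprime]
      simpa using r.reduced.symm
    exact this.dvd_of_dvd_mul_left hx
  have hqε : q * ε < 3 / 4 := by
    by_contra! hcon
    have hcardle : A.card ≤
        (Finset.Icc (-⌊q * ε + 1 / 4⌋) ⌊q * ε + 1 / 4⌋ ×ˢ Finset.range (N / q + 1)).card := by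
      apply Finset.card_le_card_of_injOn (fun h => (b h, h / q))
      · intro h hh
        have h1 := abs_le.1 (hb h hh)
        simp only [Finset.coe_product, Set.mem_prod, Finset.mem_coe, Finset.mem_Icc,
          Finset.mem_range]
        refine ⟨⟨?_, ?_⟩, ?_⟩
        · rw [neg_le, Int.le_floor]; push_cast; linarith [h1.1]
        · rw [Int.le_floor]; exact h1.2
        · exact Nat.lt_succ_of_le (Nat.div_le_div_right (hA h hh).2)
      · intro h hh h' hh' heq
        simp only [Prod.mk.injEq] at heq
        have hd : (q : ℤ) ∣ ((h : ℤ) - h') := by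
          apply hcop
          refine ⟨round (β * h) - round (β * h'), ?_⟩
          have := heq.1
          simp only [b] at this
          linear_combination this
        have hm : h' % q = h % q := by
          have := (Int.natCast_modEq_iff (a := h') (b := h) (n := q)).1
            (Int.modEq_iff_dvd.2 (by simpa using hd))
          exact this
        rw [← Nat.div_add_mod h q, ← Nat.div_add_mod h' q, heq.2, hm]
    rw [Finset.card_product, Int.card_Icc, Finset.card_range] at hcardle
    have hfl : (0 : ℤ) ≤ ⌊q * ε + 1 / 4⌋ := Int.floor_nonneg.2 (by positivity)
    have h1 : (((⌊q * ε + 1 / 4⌋ + 1 - -⌊q * ε + 1 / 4⌋).toNat : ℕ) : ℝ) ≤ 4 * (q * ε) := by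
      have h2 : (((⌊q * ε + 1 / 4⌋ + 1 - -⌊q * ε + 1 / 4⌋).toNat : ℤ) : ℝ)
          = ((⌊q * ε + 1 / 4⌋ + 1 - -⌊q * ε + 1 / 4⌋ : ℤ) : ℝ) := by
        rw [Int.toNat_of_nonneg (by omega)]
      rw [Int.cast_natCast] at h2
      rw [h2]; push_cast
      have := Int.floor_le (q * ε + 1 / 4)
      linarith
    have h2 : (((N / q + 1 : ℕ)) : ℝ) ≤ 5 * N / q := by
      have h3 : ((N / q : ℕ) : ℝ) ≤ N / q := Nat.cast_div_le
      have h4 : (1 : ℝ) ≤ 4 * N / q := by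
        rw [le_div_iff₀ hqR]; rw [one_mul]; exact_mod_cast hrden
      push_cast
      calc ((N / q : ℕ) : ℝ) + 1 ≤ N / q + 4 * N / q := by linarith
        _ = 5 * N / q := by ring
    have h5 : (A.card : ℝ) ≤ 4 * (q * ε) * (5 * N / q) := by
      have h0 := (Nat.cast_le (α := ℝ)).2 hcardle
      rw [Nat.cast_mul] at h0
      exact h0.trans (by gcongr)
    have h6 : 4 * (q * ε) * (5 * N / q) = 20 * ε * N := by field_simp; ring
    have h7 : 20 * ε * N < δ * N := by gcongr
    linarith
  have hb0 : ∀ h ∈ A, b h = 0 := by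
    intro h hh
    have : |(b h : ℝ)| < 1 := by linarith [hb h hh]
    exact Int.abs_lt_one_iff.1 (by exact_mod_cast this)
  have hdvd : ∀ h ∈ A, q ∣ h := by
    intro h hh
    have : (q : ℤ) ∣ h := hcop _ ⟨round (β * h), by have := hb0 h hh; simp only [b] at this; linarith⟩
    exact_mod_cast this
  have hcardq : A.card * q ≤ N := by
    have : A.card ≤ (Finset.Icc 1 (N / q)).card := by
      apply Finset.card_le_card_of_injOn (fun h => h / q)
      · intro h hh
        simp only [Finset.coe_Icc, Set.mem_Icc]
        exact ⟨Nat.div_pos (Nat.le_of_dvd (hA h hh).1 (hdvd h hh)) hq0,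
          Nat.div_le_div_right (hA h hh).2⟩
      · intro h hh h' hh' heq
        exact (Nat.div_left_inj (hdvd h hh) (hdvd h' hh')).1 heq
    rw [Nat.card_Icc, Nat.add_sub_cancel] at this
    exact (Nat.mul_le_mul_right q this).trans (Nat.div_mul_le_self N q)
  have hqδ : q * δ ≤ 1 := by
    have h1 : (A.card : ℝ) * q ≤ N := by exact_mod_cast hcardq
    have h2 : δ * N * q ≤ N := le_trans (by gcongr) h1
    have : (q * δ) * N ≤ 1 * N := by linarith
    exact le_of_mul_le_mul_right this (by linarith)
  refine ⟨q, hq0, hqδ, ?_⟩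
  have hAne : A.Nonempty := by
    rw [← Finset.card_pos]
    have : (0 : ℝ) < A.card := lt_of_lt_of_le (by positivity) hcard
    exact_mod_cast this
  set h := A.max' hAne with hh
  have hhA : h ∈ A := A.max'_mem hAne
  have hcardh : A.card ≤ h := by
    have : A ⊆ Finset.Icc 1 h := fun x hx =>
      Finset.mem_Icc.2 ⟨(hA x hx).1, A.le_max' x hx⟩
    simpa using Finset.card_le_card this
  have hhR : δ * N ≤ h := hcard.trans (by exact_mod_cast hcardh)
  have hθh : |θ| * h ≤ ε := by
    have h0 := hb0 h hhA
    have h1 : β * h - round (β * h) = θ * h := by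
      have h2 : (b h : ℝ) = 0 := by exact_mod_cast h0
      simp only [b] at h2
      push_cast at h2
      rw [← hrq] at h2
      have : (q : ℝ) * (r * h - round (β * h)) = 0 := by linarith
      have h3 := (mul_eq_zero.1 this).resolve_left hqR.ne'
      rw [hθ]; linarith
    have := hclose h hhA
    unfold nearestIntDist at this
    rwa [h1, abs_mul, Nat.abs_cast] at this
  have hqβ : nearestIntDist (q * β) ≤ q * |θ| := by
    refine (nearestIntDist_le _ r.num).trans ?_
    rw [show (q : ℝ) * β - r.num = q * θ by rw [← hrq, hθ]; ring, abs_mul, abs_of_pos hqR]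
  calc nearestIntDist (q * β) * (δ ^ 2 * N) ≤ q * |θ| * (δ ^ 2 * N) := by gcongr
    _ = (q * δ) * (|θ| * (δ * N)) := by ring
    _ ≤ 1 * (|θ| * h) := by gcongr
    _ ≤ ε := by linarith

/-! ### Weyl's inequality -/

/-- The additive character `x ↦ exp (2 π i x)`. -/
noncomputable def unitExp (x : ℝ) : ℂ := Complex.exp (2 * Real.pi * x * Complex.I)

lemma unitExp_add (x y : ℝ) : unitExp (x + y) = unitExp x * unitExp y := by
  simp only [unitExp, ← Complex.exp_add]; push_cast; ring_nf

lemma norm_unitExp (x : ℝ) : ‖unitExp x‖ = 1 := by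
  have := Complex.norm_exp_ofReal_mul_I (2 * Real.pi * x)
  push_cast at this
  exact this

lemma conj_unitExp (x : ℝ) : (starRingEnd ℂ) (unitExp x) = unitExp (-x) := by
  simp [unitExp, ← Complex.exp_conj, map_ofNat (starRingEnd ℂ) 2]

lemma unitExp_nat_mul (n : ℕ) (x : ℝ) : unitExp (n * x) = unitExp x ^ n := by
  simp only [unitExp, ← Complex.exp_nat_mul]; push_cast; ring_nf

lemma unitExp_intCast (k : ℤ) : unitExp k = 1 := by
  rw [unitExp, Complex.exp_eq_one_iff]
  exact ⟨k, by push_cast; ring⟩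

lemma four_mul_nearestIntDist_le (x : ℝ) : 4 * nearestIntDist x ≤ ‖unitExp x - 1‖ := by
  set y := x - round x with hy
  have h1 : unitExp x = unitExp y := by
    have : x = y + ((round x : ℤ) : ℝ) := by rw [hy]; ring
    conv_lhs => rw [this, unitExp_add, unitExp_intCast, mul_one]
  have h2 := Complex.norm_exp_I_mul_ofReal_sub_one (2 * Real.pi * y)
  have h3 : Complex.exp (Complex.I * ((2 * Real.pi * y : ℝ) : ℂ)) = unitExp y := by
    rw [unitExp]; push_cast; ring_nf
  have hyle : |y| ≤ 1 / 2 := abs_sub_round x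
  have hpi := Real.pi_pos
  have h4 := Real.mul_abs_le_abs_sin (x := Real.pi * y) (by
    rw [abs_mul, abs_of_pos hpi]; nlinarith)
  rw [h1, ← h3, h2, norm_mul, show 2 * Real.pi * y / 2 = Real.pi * y by ring]
  rw [abs_mul, abs_of_pos hpi] at h4
  have h5 : 2 / Real.pi * (Real.pi * |y|) = 2 * |y| := by field_simp
  rw [h5] at h4
  simp only [Real.norm_eq_abs, abs_two]
  show 4 * |y| ≤ _
  linarith

lemma norm_sum_unitExp_mul_le (x c : ℝ) (N : ℕ) :
    ‖∑ n ∈ Finset.range N, unitExp (c + n * x)‖ * (2 * nearestIntDist x) ≤ 1 := by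
  have h1 : ∑ n ∈ Finset.range N, unitExp (c + n * x)
      = unitExp c * ∑ n ∈ Finset.range N, unitExp x ^ n := by
    rw [Finset.mul_sum]
    exact Finset.sum_congr rfl fun n _ => by rw [unitExp_add, unitExp_nat_mul]
  rw [h1, norm_mul, norm_unitExp, one_mul]
  have h2 : ‖(∑ n ∈ Finset.range N, unitExp x ^ n) * (unitExp x - 1)‖ ≤ 2 := by
    rw [geom_sum_mul]
    refine (norm_sub_le _ _).trans ?_
    rw [norm_pow, norm_unitExp]; norm_num
  rw [norm_mul] at h2
  have h3 := four_mul_nearestIntDist_le x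
  have h4 := norm_nonneg (∑ n ∈ Finset.range N, unitExp x ^ n)
  nlinarith [mul_le_mul_of_nonneg_left h3 h4]

lemma norm_sq_sum_le (z : ℕ → ℂ) (N : ℕ) :
    ‖∑ n ∈ Finset.range N, z n‖ ^ 2 ≤
      2 * ∑ h ∈ Finset.range N,
        ‖∑ n ∈ Finset.range (N - h), z (n + h) * (starRingEnd ℂ) (z n)‖ := by
  have key : ∀ N : ℕ, ‖∑ n ∈ Finset.range N, z n‖ ^ 2 ≤
      2 * (∑ m ∈ Finset.range N, ∑ n ∈ Finset.range (m + 1),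
        z m * (starRingEnd ℂ) (z n)).re := by
    intro N
    induction N with
    | zero => simp
    | succ N ih =>
      rw [Finset.sum_range_succ, Finset.sum_range_succ _ N]
      set S := ∑ n ∈ Finset.range N, z n with hS
      have h1 : ∑ n ∈ Finset.range (N + 1), z N * (starRingEnd ℂ) (z n)
          = z N * (starRingEnd ℂ) (S + z N) := by
        rw [← Finset.mul_sum, Finset.sum_range_succ, map_add, hS, map_sum]
      rw [h1, Complex.add_re]
      have h2 : ‖S + z N‖ ^ 2 = ‖S‖ ^ 2 + 2 * (z N * (starRingEnd ℂ) S).re + ‖z N‖ ^ 2 := by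
        simp only [Complex.sq_norm, Complex.normSq_apply, Complex.mul_re, Complex.conj_re,
          Complex.conj_im, Complex.add_re, Complex.add_im]
        ring
      have h3 : (z N * (starRingEnd ℂ) (S + z N)).re
          = (z N * (starRingEnd ℂ) S).re + ‖z N‖ ^ 2 := by
        simp only [Complex.sq_norm, Complex.normSq_apply, Complex.mul_re, Complex.conj_re,
          Complex.conj_im, Complex.add_re, Complex.add_im, map_add]
        ring
      rw [h2, h3]
      nlinarith [sq_nonneg ‖z N‖]
  refine (key N).trans ?_
  have h4 : ∑ m ∈ Finset.range N, ∑ n ∈ Finset.range (m + 1), z m * (starRingEnd ℂ) (z n)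
      = ∑ h ∈ Finset.range N, ∑ n ∈ Finset.range (N - h), z (n + h) * (starRingEnd ℂ) (z n) := by
    rw [← Finset.sum_range_diag_flip N fun h n => z (n + h) * (starRingEnd ℂ) (z n)]
    refine Finset.sum_congr rfl fun m _ => ?_
    rw [← Finset.sum_range_reflect]
    refine Finset.sum_congr rfl fun n hn => ?_
    have : n ≤ m := Nat.lt_succ_iff.1 (Finset.mem_range.1 hn)
    rw [show m - n + n = m by omega, show m + 1 - 1 - n = m - n by omega]
  rw [h4]
  have := (Complex.re_le_norm _).trans (norm_sum_le (Finset.range N) fun h =>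
    ∑ n ∈ Finset.range (N - h), z (n + h) * (starRingEnd ℂ) (z n))
  linarith

open fwdDiff in
lemma fwdDiff_iter_sub_shift (p : ℕ → ℝ) (h j : ℕ) (γ : ℝ)
    (hp : ∀ n, (fwdDiff 1)^[j + 1] p n = γ) (n : ℕ) :
    (fwdDiff 1)^[j] (fun n => p (n + h) - p n) n = h * γ := by
  have h1 : (fun n => p (n + h) - p n) = (fun n => p (n + h)) + (-1 : ℝ) • p := by
    ext n; simp [sub_eq_add_neg]
  rw [h1, fwdDiff_iter_add, fwdDiff_iter_const_smul]
  simp only [Pi.add_apply, Pi.smul_apply, fwdDiff_iter_comp_add, smul_eq_mul]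
  have h2 : ∀ h : ℕ, (fwdDiff 1)^[j] p (n + h) = (fwdDiff 1)^[j] p n + h * γ := by
    intro h
    induction h with
    | zero => simp
    | succ h ih =>
      have h3 := hp (n + h)
      rw [Function.iterate_succ_apply', fwdDiff] at h3
      push_cast
      rw [← add_assoc]
      linarith
  rw [h2]; ring

lemma exists_many_large_differences {Y : ℝ} (hY : 2 ≤ Y) {N : ℕ} {p : ℕ → ℝ}
    (hNY : Y ^ 5 ≤ N) (hS : N ≤ Y * ‖∑ n ∈ Finset.range N, unitExp (p n)‖) :
    ∃ A : Finset ℕ, (∀ h ∈ A, 1 ≤ h ∧ h < N ∧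
      N ≤ Y ^ 5 * ‖∑ n ∈ Finset.range (N - h), unitExp (p (n + h) - p n)‖) ∧
      N ≤ Y ^ 4 * A.card := by
  classical
  set T : ℕ → ℝ := fun h => ‖∑ n ∈ Finset.range (N - h), unitExp (p (n + h) - p n)‖ with hT
  have hY0 : 0 < Y := by linarith
  have hNpos : (0 : ℝ) < N := lt_of_lt_of_le (by positivity) hNY
  have hTN : ∀ h, T h ≤ N := by
    intro h
    refine (norm_sum_le _ _).trans ?_
    simp only [norm_unitExp, Finset.sum_const, Finset.card_range, nsmul_eq_mul, mul_one]
    exact_mod_cast Nat.sub_le N h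
  have hsq : ‖∑ n ∈ Finset.range N, unitExp (p n)‖ ^ 2 ≤ 2 * ∑ h ∈ Finset.range N, T h := by
    refine (norm_sq_sum_le (fun n => unitExp (p n)) N).trans (le_of_eq ?_)
    congr 1
    refine Finset.sum_congr rfl fun h _ => ?_
    rw [hT]
    congr 1
    exact Finset.sum_congr rfl fun n _ => by rw [conj_unitExp, ← unitExp_add, sub_eq_add_neg]
  refine ⟨(Finset.range N).filter fun h => 1 ≤ h ∧ N ≤ Y ^ 5 * T h, ?_, ?_⟩
  · intro h hh
    simp only [Finset.mem_filter, Finset.mem_range] at hh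
    exact ⟨hh.2.1, hh.1, hh.2.2⟩
  set A := (Finset.range N).filter fun h => 1 ≤ h ∧ N ≤ Y ^ 5 * T h with hA
  have hsum : ∑ h ∈ Finset.range N, T h ≤ N + A.card * N + N * (N / Y ^ 5) := by
    have hb : ∀ h ∈ Finset.range N,
        T h ≤ (if h = 0 then (N : ℝ) else 0) + (if h ∈ A then (N : ℝ) else 0) + N / Y ^ 5 := by
      intro h hh
      have h5 : (0 : ℝ) ≤ N / Y ^ 5 := by positivity
      by_cases h0 : h = 0
      · have : (0 : ℝ) ≤ if h ∈ A then (N : ℝ) else 0 := by split_ifs <;> positivity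
        rw [if_pos h0]; linarith [hTN h]
      · rw [if_neg h0]
        by_cases hAh : h ∈ A
        · rw [if_pos hAh]; linarith [hTN h]
        · rw [if_neg hAh]
          have : ¬ (N ≤ Y ^ 5 * T h) := fun hc =>
            hAh (Finset.mem_filter.2 ⟨hh, Nat.one_le_iff_ne_zero.2 h0, hc⟩)
          rw [zero_add, zero_add, le_div_iff₀ (by positivity)]
          linarith
    refine (Finset.sum_le_sum hb).trans ?_
    rw [Finset.sum_add_distrib, Finset.sum_add_distrib, Finset.sum_const, Finset.card_range,
      nsmul_eq_mul, Finset.sum_ite_eq', ← Finset.sum_filter,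
      Finset.sum_const, nsmul_eq_mul]
    have h1 : (if 0 ∈ Finset.range N then (N : ℝ) else 0) ≤ N := by split_ifs <;> linarith
    have h2 : (((Finset.range N).filter (· ∈ A)).card : ℝ) ≤ A.card := by
      exact_mod_cast Finset.card_le_card fun x hx => (Finset.mem_filter.1 hx).2
    gcongr
  have h1 : (N : ℝ) ^ 2 ≤ Y ^ 2 * (2 * (N + A.card * N + N * (N / Y ^ 5))) := by
    calc (N : ℝ) ^ 2 ≤ (Y * ‖∑ n ∈ Finset.range N, unitExp (p n)‖) ^ 2 := by gcongr
      _ = Y ^ 2 * ‖∑ n ∈ Finset.range N, unitExp (p n)‖ ^ 2 := by ring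
      _ ≤ Y ^ 2 * (2 * (N + A.card * N + N * (N / Y ^ 5))) := by gcongr; linarith
  have h2 : (N : ℝ) ≤ 2 * Y ^ 2 * (1 + A.card) + 2 * N / Y ^ 3 := by
    have : Y ^ 2 * (2 * (N + A.card * N + N * (N / Y ^ 5)))
        = N * (2 * Y ^ 2 * (1 + A.card) + 2 * N / Y ^ 3) := by
      field_simp
    rw [this, sq] at h1
    exact le_of_mul_le_mul_left h1 hNpos
  have h3 : 2 * N / Y ^ 3 ≤ N / 4 := by
    have : (2 : ℝ) ^ 3 ≤ Y ^ 3 := by gcongr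
    rw [div_le_div_iff₀ (by positivity) (by norm_num)]
    nlinarith
  have h4 : 2 * Y ^ 2 ≤ N / 4 := by
    have : (2 : ℝ) ^ 3 ≤ Y ^ 3 := by gcongr
    nlinarith [sq_nonneg Y, mul_le_mul_of_nonneg_left this (sq_nonneg Y)]
  have h5 : (4 : ℝ) * Y ^ 2 * A.card ≤ Y ^ 4 * A.card := by
    have : (2 : ℝ) ^ 2 ≤ Y ^ 2 := by gcongr
    gcongr
    nlinarith [sq_nonneg Y]
  linarith

theorem exists_close_of_large_unitExp_sum (j : ℕ) : ∃ c : ℕ, ∀ (Y : ℝ) (N : ℕ) (p : ℕ → ℝ) (γ : ℝ),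
    2 ≤ Y → 1 ≤ N → (∀ n, (fwdDiff 1)^[j + 1] p n = γ) →
    N ≤ Y * ‖∑ n ∈ Finset.range N, unitExp (p n)‖ →
    ∃ q : ℕ, 1 ≤ q ∧ q ≤ Y ^ c ∧ (N : ℝ) ^ (j + 1) * nearestIntDist (q * γ) ≤ Y ^ c := by
  induction j with
  | zero =>
    refine ⟨1, fun Y N p γ hY hN hp hS => ⟨1, le_rfl, by simpa using by linarith, ?_⟩⟩
    have hp' : ∀ n : ℕ, p n = p 0 + n * γ := by
      intro n
      induction n with
      | zero => simp
      | succ n ih =>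
        have := hp n
        simp only [zero_add, Function.iterate_one, fwdDiff] at this
        push_cast
        linarith
    have h1 := norm_sum_unitExp_mul_le γ (p 0) N
    simp only [← hp'] at h1
    have h2 := nearestIntDist_nonneg γ
    simp only [zero_add, pow_one, Nat.cast_one, one_mul]
    have h3 := mul_le_mul_of_nonneg_right hS h2
    nlinarith
  | succ j ih =>
    obtain ⟨c, hc⟩ := ih
    obtain ⟨e, he⟩ : ∃ e, e = 5 * (j + 1) + 5 * c := ⟨_, rfl⟩
    obtain ⟨d, hd⟩ : ∃ d, d = 4 + 5 * c := ⟨_, rfl⟩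
    obtain ⟨c1, hc1⟩ : ∃ c1, c1 = e + d + 5 := ⟨_, rfl⟩
    refine ⟨c1 * (j + 2) + (e + 2 * d) + (d + 5 * c), fun Y N p γ hY hN hp hS => ?_⟩
    have hY1 : 1 ≤ Y := by linarith
    have hY0 : 0 < Y := by linarith
    have hN1 : (1 : ℝ) ≤ N := by exact_mod_cast hN
    rcases le_or_gt (N : ℝ) (Y ^ c1) with hsmall | hbig
    · refine ⟨1, le_rfl, by simpa using one_le_pow₀ hY1, ?_⟩
      calc (N : ℝ) ^ (j + 1 + 1) * nearestIntDist ((1 : ℕ) * γ)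
          ≤ (Y ^ c1) ^ (j + 1 + 1) * 1 := by
            gcongr
            · exact nearestIntDist_nonneg _
            · exact nearestIntDist_le_one _
        _ = Y ^ (c1 * (j + 2)) := by rw [mul_one, ← pow_mul]
        _ ≤ _ := pow_le_pow_right₀ hY1 (by omega)
    have hN5 : Y ^ 5 ≤ N := (pow_le_pow_right₀ hY1 (by omega)).trans hbig.le
    obtain ⟨A, hA, hAcard⟩ := exists_many_large_differences hY hN5 hS
    have hY5 : 2 ≤ Y ^ 5 := hY.trans (le_self_pow₀ hY1 (by norm_num))
    have hq : ∀ h ∈ A, ∃ q : ℕ, 1 ≤ q ∧ q ≤ Y ^ (5 * c) ∧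
        (N : ℝ) ^ (j + 1) * nearestIntDist (q * (h * γ)) ≤ Y ^ e := by
      intro h hh
      obtain ⟨h1, h2, h3⟩ := hA h hh
      obtain ⟨q, hq1, hq2, hq3⟩ := hc (Y ^ 5) (N - h) (fun n => p (n + h) - p n) (h * γ) hY5
        (by omega) (fwdDiff_iter_sub_shift p h (j + 1) γ hp)
        (le_trans (by exact_mod_cast Nat.sub_le N h) h3)
      refine ⟨q, hq1, by rwa [pow_mul], ?_⟩
      have h4 : (N : ℝ) ≤ Y ^ 5 * (N - h : ℕ) := by
        refine h3.trans ?_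
        gcongr
        refine (norm_sum_le _ _).trans ?_
        simp [norm_unitExp]
      calc (N : ℝ) ^ (j + 1) * nearestIntDist (q * (h * γ))
          ≤ (Y ^ 5 * (N - h : ℕ)) ^ (j + 1) * nearestIntDist (q * (h * γ)) := by
            gcongr
            exact nearestIntDist_nonneg _
        _ = (Y ^ 5) ^ (j + 1) * (((N - h : ℕ) : ℝ) ^ (j + 1) * nearestIntDist (q * (h * γ))) := by
            ring
        _ ≤ (Y ^ 5) ^ (j + 1) * (Y ^ 5) ^ c := by gcongr
        _ = Y ^ e := by rw [← pow_mul, ← pow_mul, ← pow_add, he]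
    choose! qf hqf1 hqf2 hqf3 using hq
    set Q := ⌊Y ^ (5 * c)⌋₊ with hQ
    have hQ1 : 1 ≤ Q := Nat.le_floor (by simpa using one_le_pow₀ hY1)
    have hQle : (Q : ℝ) ≤ Y ^ (5 * c) := Nat.floor_le (by positivity)
    have hQpos : (0 : ℝ) < Q := by exact_mod_cast hQ1
    obtain ⟨q, hqmem, hqcard⟩ := Finset.exists_le_card_fiber_of_nsmul_le_card_of_maps_to
      (s := A) (t := Finset.Icc 1 Q) (f := qf) (b := (A.card : ℝ) / Q)
      (fun h hh => Finset.mem_Icc.2 ⟨hqf1 h hh, Nat.le_floor (hqf2 h hh)⟩)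
      ⟨1, Finset.mem_Icc.2 ⟨le_rfl, hQ1⟩⟩
      (by rw [Nat.card_Icc, Nat.add_sub_cancel, nsmul_eq_mul, mul_div_cancel₀ _ hQpos.ne'])
    have hq1 : 1 ≤ q := (Finset.mem_Icc.1 hqmem).1
    have hqQ : (q : ℝ) ≤ Y ^ (5 * c) :=
      le_trans (by exact_mod_cast (Finset.mem_Icc.1 hqmem).2) hQle
    obtain ⟨q', hq'1, hq'2, hq'3⟩ := exists_natCast_mul_close_of_many_close
      (β := q * γ) (ε := Y ^ e / (N : ℝ) ^ (j + 1)) (δ := 1 / Y ^ d) (N := N)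
      (A := A.filter fun h => qf h = q) hN
      (fun h hh => by
        have := hA h (Finset.mem_filter.1 hh).1
        exact ⟨this.1, this.2.1.le⟩)
      (by positivity)
      (by
        refine le_trans ?_ hqcard
        rw [div_mul_eq_mul_div, one_mul, div_le_div_iff₀ (by positivity) hQpos]
        calc (N : ℝ) * Q ≤ (Y ^ 4 * A.card) * Y ^ (5 * c) := by gcongr
          _ = A.card * Y ^ d := by rw [hd, pow_add]; ring)
      (by positivity)
      (fun h hh => by
        obtain ⟨h1, h2⟩ := Finset.mem_filter.1 hh
        have := hqf3 h h1
        rw [h2] at this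
        rw [le_div_iff₀ (by positivity), show (q : ℝ) * γ * h = q * (h * γ) by ring]
        linarith)
      (by
        rw [← mul_div_assoc, div_lt_div_iff₀ (by positivity) (by positivity)]
        have h32 : (20 : ℝ) ≤ Y ^ 5 := le_trans (by norm_num) (pow_le_pow_left₀ (by norm_num) hY 5)
        calc 20 * Y ^ e * Y ^ d ≤ Y ^ 5 * Y ^ e * Y ^ d := by gcongr
          _ = Y ^ c1 := by rw [hc1]; ring
          _ < N := hbig
          _ ≤ 1 * (N : ℝ) ^ (j + 1) := by
            rw [one_mul]; exact le_self_pow₀ hN1 (by omega))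
    have hq'd : (q' : ℝ) ≤ Y ^ d := by
      rw [mul_one_div, div_le_one (by positivity)] at hq'2; exact hq'2
    refine ⟨q' * q, Nat.mul_pos hq'1 hq1, ?_, ?_⟩
    · calc ((q' * q : ℕ) : ℝ) ≤ Y ^ d * Y ^ (5 * c) := by push_cast; gcongr
        _ = Y ^ (d + 5 * c) := (pow_add _ _ _).symm
        _ ≤ _ := pow_le_pow_right₀ hY1 (by omega)
    · rw [show (((q' * q : ℕ) : ℝ)) * γ = q' * (q * γ) by push_cast; ring]
      set D := nearestIntDist (q' * (q * γ)) with hD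
      have h1 : D * N * (N : ℝ) ^ (j + 1) ≤ Y ^ e * Y ^ (2 * d) := by
        rw [le_div_iff₀ (by positivity)] at hq'3
        have : D * ((1 / Y ^ d) ^ 2 * N) * (N : ℝ) ^ (j + 1) * Y ^ (2 * d)
            = D * N * (N : ℝ) ^ (j + 1) := by
          rw [mul_comm 2 d, pow_mul]; field_simp
        rw [← this]
        gcongr
      calc (N : ℝ) ^ (j + 1 + 1) * D = D * N * (N : ℝ) ^ (j + 1) := by ring
        _ ≤ Y ^ (e + 2 * d) := by rw [pow_add Y]; exact h1
        _ ≤ _ := pow_le_pow_right₀ hY1 (by omega)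

/-! ### Polynomial recurrence with a power saving -/

lemma exists_large_unitExp_sum {Y : ℝ} (hY : 2 ≤ Y) {N : ℕ} (hN : 1 ≤ N) {x : ℕ → ℝ}
    (hx : ∀ n < N, 1 < nearestIntDist (x n) * Y) :
    ∃ k : ℕ, 1 ≤ k ∧ k ≤ Y ^ 2 ∧ N ≤ Y ^ 4 * ‖∑ n ∈ Finset.range N, unitExp (k * x n)‖ := by
  by_contra! hcon
  have hY0 : 0 < Y := by linarith
  have hNpos : (0 : ℝ) < N := by exact_mod_cast hN
  set H := ⌈Y ^ 2⌉₊ with hH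
  have hH1 : Y ^ 2 ≤ H := Nat.le_ceil _
  have hH2 : (H : ℝ) < Y ^ 2 + 1 := Nat.ceil_lt_add_one (by positivity)
  set w : ℕ → ℂ := fun n => ∑ k ∈ Finset.range H, unitExp (k * x n) with hw
  have hupper : ∑ n ∈ Finset.range N, ‖w n‖ ^ 2 ≤ N * (Y ^ 2 / 4) := by
    have : ∀ n ∈ Finset.range N, ‖w n‖ ^ 2 ≤ Y ^ 2 / 4 := by
      intro n hn
      have h1 := norm_sum_unitExp_mul_le (x n) 0 H
      simp only [zero_add] at h1
      have h2 := hx n (Finset.mem_range.1 hn)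
      have h3 : ‖w n‖ ≤ Y / 2 := by
        have h4 := norm_nonneg (w n)
        change ‖w n‖ * (2 * nearestIntDist (x n)) ≤ 1 at h1
        nlinarith [mul_le_mul_of_nonneg_left h2.le h4, mul_le_mul_of_nonneg_right h1 hY0.le]
      calc ‖w n‖ ^ 2 ≤ (Y / 2) ^ 2 := by gcongr
        _ = Y ^ 2 / 4 := by ring
    refine (Finset.sum_le_sum this).trans ?_
    simp
  have hoff : ∀ d : ℤ, d ≠ 0 → |d| < H →
      ‖∑ n ∈ Finset.range N, unitExp (d * x n)‖ ≤ N / Y ^ 4 := by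
    have hpos : ∀ k : ℕ, 1 ≤ k → k < H →
        ‖∑ n ∈ Finset.range N, unitExp (k * x n)‖ ≤ N / Y ^ 4 := by
      intro k hk hkH
      have := hcon k hk (by
        have := Nat.lt_ceil.1 hkH
        exact this.le)
      rw [le_div_iff₀ (by positivity)]
      linarith
    intro d hd hdH
    rcases le_or_gt 0 d with h0 | h0
    · lift d to ℕ using h0
      have := hpos d (by omega) (by simpa using hdH)
      simpa using this
    · obtain ⟨k, hk⟩ := Int.eq_ofNat_of_zero_le (a := -d) (by omega)
      have := hpos k (by omega) (by rw [abs_of_neg h0, hk] at hdH; exact_mod_cast hdH)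
      have h1 : ∑ n ∈ Finset.range N, unitExp (d * x n)
          = (starRingEnd ℂ) (∑ n ∈ Finset.range N, unitExp (k * x n)) := by
        rw [map_sum]
        refine Finset.sum_congr rfl fun n _ => ?_
        rw [conj_unitExp]
        have : (d : ℝ) = -(k : ℝ) := by
          have : d = -(k : ℤ) := by omega
          rw [this]; push_cast; rfl
        rw [this]; ring_nf
      rwa [h1, Complex.norm_conj]
  have hexp : ∑ n ∈ Finset.range N, ‖w n‖ ^ 2 = ∑ k ∈ Finset.range H, ∑ l ∈ Finset.range H,
      (∑ n ∈ Finset.range N, unitExp (((k : ℤ) - (l : ℤ) : ℤ) * x n)).re := by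
    have h1 : ∀ n, ‖w n‖ ^ 2 = ∑ k ∈ Finset.range H, ∑ l ∈ Finset.range H,
        (unitExp (((k : ℤ) - (l : ℤ) : ℤ) * x n)).re := by
      intro n
      have h2 : ((‖w n‖ ^ 2 : ℝ) : ℂ) = ∑ k ∈ Finset.range H, ∑ l ∈ Finset.range H,
          unitExp (((k : ℤ) - (l : ℤ) : ℤ) * x n) := by
        push_cast
        rw [← Complex.mul_conj', hw, map_sum, Finset.sum_mul_sum]
        refine Finset.sum_congr rfl fun k _ => Finset.sum_congr rfl fun l _ => ?_
        rw [conj_unitExp, ← unitExp_add]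
        ring_nf
      have h3 := congrArg Complex.re h2
      rw [Complex.ofReal_re] at h3
      rw [h3, Complex.re_sum]
      exact Finset.sum_congr rfl fun k _ => Complex.re_sum _ _
    rw [Finset.sum_congr rfl fun n _ => h1 n, Finset.sum_comm]
    refine Finset.sum_congr rfl fun k _ => ?_
    rw [Finset.sum_comm]
    exact Finset.sum_congr rfl fun l _ => (Complex.re_sum _ _).symm
  have hlower : ∑ k ∈ Finset.range H, ∑ l ∈ Finset.range H,
      ((if k = l then (N : ℝ) else 0) - N / Y ^ 4) ≤ ∑ n ∈ Finset.range N, ‖w n‖ ^ 2 := by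
    rw [hexp]
    refine Finset.sum_le_sum fun k hk => Finset.sum_le_sum fun l hl => ?_
    have hk' := Finset.mem_range.1 hk
    have hl' := Finset.mem_range.1 hl
    have h5 : (0 : ℝ) ≤ N / Y ^ 4 := by positivity
    by_cases hkl : k = l
    · subst hkl
      simp [unitExp, h5]
    · rw [if_neg hkl]
      have := hoff ((k : ℤ) - l) (by omega) (by rw [abs_lt]; omega)
      have h2 := Complex.abs_re_le_norm
        (∑ n ∈ Finset.range N, unitExp (((k : ℤ) - (l : ℤ) : ℤ) * x n))
      linarith [(abs_le.1 h2).1]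
  have hval : ∑ k ∈ Finset.range H, ∑ l ∈ Finset.range H,
      ((if k = l then (N : ℝ) else 0) - N / Y ^ 4) = H * N - H ^ 2 * (N / Y ^ 4) := by
    have : ∀ k ∈ Finset.range H, ∑ l ∈ Finset.range H,
        ((if k = l then (N : ℝ) else 0) - N / Y ^ 4) = N - H * (N / Y ^ 4) := by
      intro k hk
      rw [Finset.sum_sub_distrib, Finset.sum_ite_eq, if_pos hk]
      simp
    rw [Finset.sum_congr rfl this]
    simp
    ring
  rw [hval] at hlower
  have hfin := hlower.trans hupper
  have hY4 : (4 : ℝ) ≤ Y ^ 2 := by nlinarith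
  have h6 : (H : ℝ) ^ 2 * (N / Y ^ 4) ≤ 2 * N := by
    have : (H : ℝ) ^ 2 ≤ 2 * Y ^ 4 := by
      calc (H : ℝ) ^ 2 ≤ (5 / 4 * Y ^ 2) ^ 2 := by gcongr; linarith
        _ ≤ 2 * Y ^ 4 := by nlinarith [sq_nonneg (Y ^ 2)]
    calc (H : ℝ) ^ 2 * ((N : ℝ) / Y ^ 4) ≤ 2 * Y ^ 4 * ((N : ℝ) / Y ^ 4) := by gcongr
      _ = 2 * (N : ℝ) := by field_simp
  nlinarith [mul_le_mul_of_nonneg_right hH1 hNpos.le]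

lemma fwdDiff_iter_natCast_add (F : ℝ → ℝ) (x₀ : ℝ) (j n : ℕ) :
    (fwdDiff 1)^[j] (fun n : ℕ => F (x₀ + n)) n = (fwdDiff 1)^[j] F (x₀ + n) := by
  rw [fwdDiff_iter_eq_sum_shift, fwdDiff_iter_eq_sum_shift]
  refine Finset.sum_congr rfl fun k _ => ?_
  simp [add_assoc]

lemma exists_nearestIntDist_mul_pow_le (i : ℕ) : ∃ c : ℕ, ∀ Y : ℝ, 2 ≤ Y → ∀ α : ℝ,
    ∃ t : ℕ, 1 ≤ t ∧ t ≤ Y ^ c ∧ nearestIntDist (α * t ^ (i + 1)) * Y ≤ 1 := by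
  obtain ⟨c, hc⟩ := exists_close_of_large_unitExp_sum i
  obtain ⟨a, ha⟩ : ∃ a, a = 4 * c + 2 + (i + 1).factorial := ⟨_, rfl⟩
  obtain ⟨b, hb⟩ : ∃ b, b = a * (i + 1) + 4 * c + 1 := ⟨_, rfl⟩
  refine ⟨b + 1, fun Y hY α => ?_⟩
  have hY1 : 1 ≤ Y := by linarith
  have hY0 : 0 < Y := by linarith
  set N := ⌈Y ^ b⌉₊ with hNdef
  have hNb : Y ^ b ≤ N := Nat.le_ceil _
  have hNb1 : (N : ℝ) ≤ Y ^ (b + 1) := by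
    have h1 : (N : ℝ) < Y ^ b + 1 := Nat.ceil_lt_add_one (by positivity)
    have h2 : (1 : ℝ) ≤ Y ^ b := one_le_pow₀ hY1
    rw [pow_succ]; nlinarith
  have hN1 : 1 ≤ N := Nat.one_le_iff_ne_zero.2 (by rw [hNdef]; positivity)
  have hN1R : (1 : ℝ) ≤ N := by exact_mod_cast hN1
  by_contra! hcon
  have hcon' : ∀ t : ℕ, 1 ≤ t → t ≤ N → 1 < nearestIntDist (α * t ^ (i + 1)) * Y := fun t h1 h2 =>
    hcon t h1 (le_trans (by exact_mod_cast h2) hNb1)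
  obtain ⟨k, hk1, hk2, hk3⟩ := exists_large_unitExp_sum hY hN1
    (x := fun n => α * ((1 : ℝ) + n) ^ (i + 1)) (fun n hn => by
      have := hcon' (1 + n) (by omega) (by omega)
      push_cast at this
      exact this)
  have hY4 : 2 ≤ Y ^ 4 := hY.trans (le_self_pow₀ hY1 (by norm_num))
  obtain ⟨q, hq1, hq2, hq3⟩ := hc (Y ^ 4) N (fun n => k * (α * ((1 : ℝ) + n) ^ (i + 1)))
    (k * α * (i + 1).factorial) hY4 hN1 (fun n => by
      rw [fwdDiff_iter_natCast_add (fun x => k * (α * x ^ (i + 1))) 1 (i + 1) n]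
      have : (fun x : ℝ => k * (α * x ^ (i + 1))) = (k * α : ℝ) • fun x : ℝ => x ^ (i + 1) := by
        ext x; simp [mul_assoc]
      rw [this, fwdDiff_iter_const_smul, fwdDiff_iter_eq_factorial]
      simp) hk3
  set r := q * k * (i + 1).factorial with hr
  have hr1 : 1 ≤ r := Nat.mul_pos (Nat.mul_pos hq1 hk1) (Nat.factorial_pos _)
  have hra : (r : ℝ) ≤ Y ^ a := by
    have h1 : (((i + 1).factorial : ℕ) : ℝ) ≤ Y ^ (i + 1).factorial := by
      have h2 : (((i + 1).factorial : ℕ) : ℝ) ≤ 2 ^ (i + 1).factorial := by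
        exact_mod_cast Nat.lt_two_pow_self.le
      exact h2.trans (by gcongr)
    rw [← pow_mul] at hq2
    calc (r : ℝ) = q * k * (i + 1).factorial := by rw [hr]; push_cast; ring
      _ ≤ Y ^ (4 * c) * Y ^ 2 * Y ^ (i + 1).factorial := by gcongr
      _ = Y ^ a := by rw [ha, pow_add, pow_add]
  have hrN : r ≤ N := by
    have : (r : ℝ) ≤ N := hra.trans ((pow_le_pow_right₀ hY1 (by rw [hb]; nlinarith)).trans hNb)
    exact_mod_cast this
  have hfin := hcon' r hr1 hrN
  rw [show (q : ℝ) * (k * α * (i + 1).factorial) = r * α by rw [hr]; push_cast; ring, ← pow_mul]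
    at hq3
  have h1 : nearestIntDist (α * r ^ (i + 1)) ≤ r ^ i * nearestIntDist (r * α) := by
    have := nearestIntDist_natCast_mul_le (r ^ i) (r * α)
    rw [show ((r ^ i : ℕ) : ℝ) * (r * α) = α * r ^ (i + 1) by push_cast; ring] at this
    exact_mod_cast this
  have h2 : (Y : ℝ) ^ b * nearestIntDist (r * α) ≤ Y ^ (4 * c) := by
    refine le_trans ?_ hq3
    gcongr
    · exact nearestIntDist_nonneg _
    · exact hNb.trans (le_self_pow₀ hN1R (by omega))
  have h3 : nearestIntDist (α * r ^ (i + 1)) * Y * Y ^ b ≤ Y ^ b := by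
    calc nearestIntDist (α * r ^ (i + 1)) * Y * Y ^ b
        ≤ ((Y ^ a) ^ i * nearestIntDist (r * α)) * Y * Y ^ b := by
          gcongr
          refine h1.trans ?_
          gcongr
          exact nearestIntDist_nonneg _
      _ = (Y ^ a) ^ i * Y * (Y ^ b * nearestIntDist (r * α)) := by ring
      _ ≤ (Y ^ a) ^ i * Y * Y ^ (4 * c) := by gcongr
      _ = Y ^ (a * i + 1 + 4 * c) := by rw [pow_add, pow_add, pow_mul Y a i, pow_one]
      _ ≤ Y ^ b := pow_le_pow_right₀ hY1 (by rw [hb]; nlinarith)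
  have h4 : nearestIntDist (α * r ^ (i + 1)) * Y ≤ 1 := by
    have : 0 < Y ^ b := by positivity
    nlinarith
  linarith

lemma exists_nearestIntDist_mul_pow_le_finset {ι : Type*} (j : ι → ℕ) (hj : ∀ i, 1 ≤ j i)
    (s : Finset ι) : ∃ c : ℕ, ∀ Y : ℝ, 2 ≤ Y → ∀ β : ι → ℝ,
    ∃ t : ℕ, 1 ≤ t ∧ t ≤ Y ^ c ∧ ∀ i ∈ s, nearestIntDist (β i * t ^ j i) * Y ≤ 1 := by
  classical
  induction s using Finset.induction_on with
  | empty => exact ⟨0, fun Y _ β => ⟨1, le_rfl, by simp, by simp⟩⟩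
  | insert a s ha ih =>
    obtain ⟨c₁, hc₁⟩ := ih
    obtain ⟨c₂, hc₂⟩ := exists_nearestIntDist_mul_pow_le (j a - 1)
    rw [Nat.sub_add_cancel (hj a)] at hc₂
    set D := s.sup j with hD
    refine ⟨(c₂ * D + 1) * c₁ + c₂, fun Y hY β => ?_⟩
    have hY1 : 1 ≤ Y := by linarith
    have hY0 : 0 < Y := by linarith
    obtain ⟨t₁, ht1, ht2, ht3⟩ := hc₁ (Y ^ (c₂ * D + 1)) (hY.trans (le_self_pow₀ hY1 (by omega))) β
    obtain ⟨t₂, hs1, hs2, hs3⟩ := hc₂ Y hY (β a * t₁ ^ j a)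
    refine ⟨t₁ * t₂, Nat.mul_pos ht1 hs1, ?_, ?_⟩
    · push_cast
      rw [pow_add, pow_mul]
      gcongr
    · intro i hi
      rcases Finset.mem_insert.1 hi with rfl | hi
      · push_cast
        rw [mul_pow, ← mul_assoc]
        exact hs3
      · have h1 := ht3 i hi
        have h2 : nearestIntDist (β i * ((t₁ * t₂ : ℕ) : ℝ) ^ j i)
            ≤ Y ^ (c₂ * D) * nearestIntDist (β i * t₁ ^ j i) := by
          have := nearestIntDist_natCast_mul_le (t₂ ^ j i) (β i * t₁ ^ j i)
          rw [show ((t₂ ^ j i : ℕ) : ℝ) * (β i * t₁ ^ j i) = β i * ((t₁ * t₂ : ℕ) : ℝ) ^ j i by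
            push_cast; ring] at this
          refine this.trans ?_
          gcongr
          · exact nearestIntDist_nonneg _
          · push_cast
            calc (t₂ : ℝ) ^ j i ≤ (Y ^ c₂) ^ j i := by gcongr
              _ = Y ^ (c₂ * j i) := by rw [pow_mul]
              _ ≤ Y ^ (c₂ * D) := pow_le_pow_right₀ hY1
                (Nat.mul_le_mul_left _ (Finset.le_sup (f := j) hi))
        calc nearestIntDist (β i * ((t₁ * t₂ : ℕ) : ℝ) ^ j i) * Y
            ≤ (Y ^ (c₂ * D) * nearestIntDist (β i * t₁ ^ j i)) * Y := by gcongr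
          _ = nearestIntDist (β i * t₁ ^ j i) * Y ^ (c₂ * D + 1) := by ring
          _ ≤ 1 := h1

/-- Every window of length `Y ^ l` contains an integer `s` for which `ξ * s` lies within
`Y ^ (-r)` of an integer. -/
def ReturnsWithin (ξ Y : ℝ) (r l : ℕ) : Prop :=
  ∀ x : ℝ, ∃ s : ℤ, x ≤ s ∧ (s : ℝ) ≤ x + Y ^ l ∧ nearestIntDist (ξ * s) * Y ^ r ≤ 1

lemma exists_drift_into_window {v : ℕ → ℝ} {a b δ s L : ℝ} {H : ℕ} (ha : 0 < a) (hbδ : b ≤ δ)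
    (hδ : δ ≤ 1) (hstep : ∀ h ≤ H, a ≤ fwdDiff 1 v h ∧ fwdDiff 1 v h ≤ b) (hs0 : v 0 ≤ s)
    (hs1 : s ≤ v 0 + L) (hH : L + 2 ≤ a * H) :
    ∃ m ≤ H, s + δ ≤ v m ∧ v m ≤ s + 2 * δ ∧ a * m ≤ L + 2 := by
  classical
  have hab : a ≤ b := (hstep 0 (Nat.zero_le _)).1.trans (hstep 0 (Nat.zero_le _)).2
  have hlow : ∀ h ≤ H, v 0 + a * h ≤ v h := by
    intro h
    induction h with
    | zero => intro _; simp
    | succ h ih =>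
      intro hh
      have h1 := ih (by omega)
      have h2 := (hstep h (by omega)).1
      simp only [fwdDiff] at h2
      push_cast
      linarith
  have hex : ∃ m, s + δ ≤ v m := ⟨H, by linarith [hlow H le_rfl]⟩
  have hle : Nat.find hex ≤ H := Nat.find_min' hex (by linarith [hlow H le_rfl])
  obtain ⟨k, hk⟩ : ∃ k, Nat.find hex = k + 1 := by
    refine Nat.exists_eq_succ_of_ne_zero fun h0 => ?_
    have := Nat.find_spec hex
    rw [h0] at this
    linarith
  have hprev : v k < s + δ := not_le.1 (Nat.find_min hex (by omega))
  have h2 := (hstep k (by omega)).2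
  simp only [fwdDiff] at h2
  refine ⟨Nat.find hex, hle, Nat.find_spec hex, ?_, ?_⟩
  · rw [hk]; linarith
  · have := hlow k (by omega)
    rw [hk]; push_cast; linarith

lemma fwdDiff_iter_choose_self (K n : ℕ) :
    (fwdDiff 1)^[K] (fun h : ℕ => (h.choose K : ℝ)) n = 1 := by
  induction K with
  | zero => simp
  | succ K ih =>
    rw [Function.iterate_succ_apply]
    have : fwdDiff 1 (fun h : ℕ => (h.choose (K + 1) : ℝ)) = fun h : ℕ => (h.choose K : ℝ) := by
      ext h
      simp [fwdDiff, Nat.choose_succ_succ' h K]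
    rw [this, ih]

lemma le_add_mul_of_fwdDiff_le {v : ℕ → ℝ} {b : ℝ} {m n : ℕ}
    (hstep : ∀ h < n, fwdDiff 1 v (m + h) ≤ b) : v (m + n) ≤ v m + n * b := by
  induction n with
  | zero => simp
  | succ n ih =>
    have h1 := ih fun h hh => hstep h (by omega)
    have h2 := hstep n (by omega)
    simp only [fwdDiff] at h2
    push_cast
    rw [← add_assoc]
    linarith

lemma le_of_fwdDiff_nonneg {v : ℕ → ℝ} {m n : ℕ}
    (hstep : ∀ h < n, 0 ≤ fwdDiff 1 v (m + h)) : v m ≤ v (m + n) := by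
  induction n with
  | zero => simp
  | succ n ih =>
    have h1 := ih fun h hh => hstep h (by omega)
    have h2 := hstep n (by omega)
    simp only [fwdDiff] at h2
    rw [← add_assoc]
    linarith

lemma exists_close_integer_of_fwdDiff_small (ω : ℕ → ℕ) (K : ℕ) : ∃ c : ℕ, ∀ Y ξ : ℝ, 2 ≤ Y →
    (∀ r ≤ c, ReturnsWithin ξ Y r (ω r)) → ∀ (G : ℕ → ℝ) (a b : ℝ) (H : ℕ), 0 < a →
    (∀ h ≤ H, a ≤ (fwdDiff 1)^[K + 1] G h ∧ (fwdDiff 1)^[K + 1] G h ≤ b) → b * Y ^ c ≤ 1 →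
    Y ^ c ≤ a * H → ∃ h ≤ H, ∃ s : ℤ, 1 ≤ (G h - s) * Y ∧ (G h - s) * Y ≤ 3 ∧
      nearestIntDist (ξ * s) * Y ≤ K + 1 := by
  induction K with
  | zero =>
    refine ⟨ω 1 + 2, fun Y ξ hY hret G a b H ha hG hb hH => ?_⟩
    have hY1 : 1 ≤ Y := by linarith
    have hY0 : 0 < Y := by linarith
    obtain ⟨s, hs0, hs1, hs2⟩ := hret 1 (by omega) (G 0)
    have hp : 1 ≤ Y ^ ω 1 := one_le_pow₀ hY1
    have hbY : b ≤ 1 / Y := by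
      rw [le_div_iff₀ hY0]
      have hb0 : 0 < b := ha.trans_le ((hG 0 (Nat.zero_le _)).1.trans (hG 0 (Nat.zero_le _)).2)
      refine le_trans ?_ hb
      gcongr
      exact le_self_pow₀ hY1 (by omega)
    obtain ⟨m, hm, h1, h2, -⟩ := exists_drift_into_window ha hbY
      ((div_le_one hY0).2 hY1) (by simpa using hG) hs0 hs1 (by
        refine le_trans ?_ hH
        have : Y ^ ω 1 * 3 ≤ Y ^ ω 1 * Y ^ 2 := by gcongr; nlinarith
        rw [pow_add]; linarith)
    have hYi : 1 / Y * Y = 1 := by field_simp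
    refine ⟨m, hm, s, ?_, ?_, by simpa using hs2⟩ <;> nlinarith
  | succ K ih =>
    obtain ⟨c, hc⟩ := ih
    obtain ⟨r, hr⟩ : ∃ r, r = (2 * c + 3) * (K + 1) + 1 := ⟨_, rfl⟩
    refine ⟨3 * c + 5 + r + (ω r + 2), fun Y ξ hY hret G a b H ha hG hb hH => ?_⟩
    have hY1 : 1 ≤ Y := by linarith
    have hY0 : 0 < Y := by linarith
    have hb0 : 0 < b := ha.trans_le ((hG 0 (Nat.zero_le _)).1.trans (hG 0 (Nat.zero_le _)).2)
    have hab : a ≤ b := (hG 0 (Nat.zero_le _)).1.trans (hG 0 (Nat.zero_le _)).2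
    set v : ℕ → ℝ := (fwdDiff 1)^[K + 1] G with hv
    have hstep : ∀ h ≤ H, a ≤ fwdDiff 1 v h ∧ fwdDiff 1 v h ≤ b := by
      intro h hh
      have := hG h hh
      rwa [Function.iterate_succ_apply'] at this
    obtain ⟨s, hs0, hs1, hs2⟩ := hret r (by omega) (v 0)
    set δ : ℝ := 1 / Y ^ (c + 2) with hδ
    have hδ0 : 0 < δ := by positivity
    have hδY : δ * Y ^ (c + 2) = 1 := by rw [hδ]; field_simp
    have hδ1 : δ ≤ 1 := (div_le_one (by positivity)).2 (one_le_pow₀ hY1)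
    set H' := ⌈Y ^ (2 * c + 2)⌉₊ with hH'
    have hH'1 : Y ^ (2 * c + 2) ≤ H' := Nat.le_ceil _
    have hH'2 : (H' : ℝ) ≤ Y ^ (2 * c + 3) := by
      have h1 : (H' : ℝ) < Y ^ (2 * c + 2) + 1 := Nat.ceil_lt_add_one (by positivity)
      have h2 : (1 : ℝ) ≤ Y ^ (2 * c + 2) := one_le_pow₀ hY1
      rw [pow_succ]; nlinarith
    have hH'b : H' * b ≤ δ := by
      rw [hδ, le_div_iff₀ (by positivity)]
      calc H' * b * Y ^ (c + 2) ≤ Y ^ (2 * c + 3) * b * Y ^ (c + 2) := by gcongr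
        _ = b * Y ^ (3 * c + 5) := by ring
        _ ≤ b * Y ^ (3 * c + 5 + r + (ω r + 2)) := by
          refine mul_le_mul_of_nonneg_left (pow_le_pow_right₀ hY1 ?_) hb0.le
          omega
        _ ≤ 1 := hb
    have hbδ : b ≤ δ := by
      have : (1 : ℝ) ≤ H' := (one_le_pow₀ hY1).trans hH'1
      nlinarith
    have hL : Y ^ ω r + 3 ≤ a * H := by
      refine le_trans ?_ hH
      have h1 : (1 : ℝ) ≤ Y ^ ω r := one_le_pow₀ hY1
      calc Y ^ ω r + 3 ≤ Y ^ ω r * 4 := by linarith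
        _ ≤ Y ^ ω r * Y ^ 2 := by gcongr; nlinarith
        _ = Y ^ (ω r + 2) := by rw [pow_add]
        _ ≤ _ := pow_le_pow_right₀ hY1 (by omega)
    obtain ⟨m, hm, h1, h2, h3⟩ := exists_drift_into_window ha hbδ hδ1 hstep hs0 hs1 (by linarith)
    have hmH : m + H' ≤ H := by
      have h4 : a * H' ≤ 1 := by
        have : a * H' ≤ H' * b := by rw [mul_comm]; gcongr
        linarith
      have : a * ((m : ℝ) + H') ≤ a * H := by linarith
      exact_mod_cast le_of_mul_le_mul_left this ha
    set G' : ℕ → ℝ := fun h => G (h + m) - s * (h.choose (K + 1) : ℝ) with hG'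
    have hG'd : ∀ h, (fwdDiff 1)^[K + 1] G' h = v (m + h) - s := by
      intro h
      have : G' = (fun h => G (h + m)) + (-s : ℝ) • fun h : ℕ => (h.choose (K + 1) : ℝ) := by
        ext x; simp [hG', sub_eq_add_neg]
      rw [this, fwdDiff_iter_add, Pi.add_apply, fwdDiff_iter_comp_add, fwdDiff_iter_const_smul,
        Pi.smul_apply, fwdDiff_iter_choose_self, ← hv, add_comm h m]
      simp [sub_eq_add_neg]
    obtain ⟨h, hh, s', hs'1, hs'2, hs'3⟩ := hc Y ξ hY
      (fun r' hr' => hret r' (by omega)) G' δ (3 * δ) H' hδ0 (by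
        intro h hh
        rw [hG'd]
        have hup : v (m + h) ≤ v m + h * b :=
          le_add_mul_of_fwdDiff_le fun k hk => (hstep (m + k) (by omega)).2
        have hlo : v m ≤ v (m + h) :=
          le_of_fwdDiff_nonneg fun k hk => ha.le.trans (hstep (m + k) (by omega)).1
        have : h * b ≤ H' * b := by gcongr
        constructor <;> linarith) (by
        have : δ * Y ^ (c + 2) = δ * Y ^ c * Y ^ 2 := by ring
        have h5 : 0 < δ * Y ^ c := by positivity
        nlinarith) (by
        calc Y ^ c = δ * Y ^ (c + 2) * Y ^ c := by rw [hδY, one_mul]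
          _ = δ * Y ^ (2 * c + 2) := by ring
          _ ≤ δ * H' := by gcongr)
    refine ⟨h + m, by omega, s * (h.choose (K + 1) : ℕ) + s', ?_, ?_, ?_⟩
    · push_cast; simp only [hG'] at hs'1; linarith
    · push_cast; simp only [hG'] at hs'2; linarith
    · have h6 : nearestIntDist (ξ * ((s * (h.choose (K + 1) : ℕ) + s' : ℤ) : ℝ))
          ≤ (h.choose (K + 1) : ℕ) * nearestIntDist (ξ * s) + nearestIntDist (ξ * s') := by
        have h7 := nearestIntDist_natCast_mul_le (h.choose (K + 1)) (ξ * s)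
        have h8 := nearestIntDist_add_le ((h.choose (K + 1) : ℕ) * (ξ * s)) (ξ * s')
        rw [show ξ * ((s * (h.choose (K + 1) : ℕ) + s' : ℤ) : ℝ)
          = (h.choose (K + 1) : ℕ) * (ξ * s) + ξ * s' by push_cast; ring]
        linarith
      have h9 : ((h.choose (K + 1) : ℕ) : ℝ) ≤ Y ^ ((2 * c + 3) * (K + 1)) := by
        calc ((h.choose (K + 1) : ℕ) : ℝ) ≤ (h : ℝ) ^ (K + 1) := by
              exact_mod_cast Nat.choose_le_pow h (K + 1)
          _ ≤ (Y ^ (2 * c + 3)) ^ (K + 1) := by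
              gcongr
              exact le_trans (by exact_mod_cast hh) hH'2
          _ = _ := by rw [pow_mul]
      have h10 : (h.choose (K + 1) : ℕ) * nearestIntDist (ξ * s) * Y ≤ 1 := by
        calc (h.choose (K + 1) : ℕ) * nearestIntDist (ξ * s) * Y
            ≤ Y ^ ((2 * c + 3) * (K + 1)) * nearestIntDist (ξ * s) * Y := by
              gcongr
              exact nearestIntDist_nonneg _
          _ = nearestIntDist (ξ * s) * Y ^ r := by rw [hr]; ring
          _ ≤ 1 := hs2
      have h11 := mul_le_mul_of_nonneg_right h6 hY0.le
      rw [add_mul] at h11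
      push_cast at h11 ⊢
      linarith

lemma hasDerivAt_fwdDiff_iter {f f' : ℝ → ℝ} (hf : ∀ x, 0 < x → HasDerivAt f (f' x) x) (K : ℕ) :
    ∀ x, 0 < x → HasDerivAt ((fwdDiff 1)^[K] f) ((fwdDiff 1)^[K] f' x) x := by
  induction K with
  | zero => simpa using hf
  | succ K ih =>
    intro x hx
    simp only [Function.iterate_succ_apply']
    exact (HasDerivAt.comp_add_const x 1 (ih (x + 1) (by linarith))).sub (ih x hx)

lemma exists_fwdDiff_iter_rpow_eq (K : ℕ) (θ : ℝ) {x : ℝ} (hx : 0 < x) :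
    ∃ ζ : ℝ, x ≤ ζ ∧ ζ ≤ x + K ∧ (fwdDiff 1)^[K] (fun x : ℝ => x ^ θ) x =
      (∏ i ∈ Finset.range K, (θ - i)) * ζ ^ (θ - K) := by
  induction K generalizing θ x with
  | zero => exact ⟨x, le_rfl, by simp, by simp⟩
  | succ K ih =>
    have hd : ∀ y : ℝ, 0 < y → HasDerivAt ((fwdDiff 1)^[K] fun x : ℝ => x ^ θ)
        (θ * (fwdDiff 1)^[K] (fun x : ℝ => x ^ (θ - 1)) y) y := by
      intro y hy
      have := hasDerivAt_fwdDiff_iter (f := fun x : ℝ => x ^ θ)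
        (f' := θ • fun x : ℝ => x ^ (θ - 1))
        (fun x hx => by
          simpa using Real.hasDerivAt_rpow_const (x := x) (p := θ) (Or.inl hx.ne')) K y hy
      rwa [fwdDiff_iter_const_smul, Pi.smul_apply, smul_eq_mul] at this
    obtain ⟨y, hy, hy'⟩ := exists_hasDerivAt_eq_slope _ _ (show x < x + 1 by linarith)
      (fun y hy => (hd y (hx.trans_le hy.1)).continuousAt.continuousWithinAt)
      (fun y hy => hd y (hx.trans hy.1))
    obtain ⟨ζ, h1, h2, h3⟩ := ih (θ - 1) (hx.trans hy.1)
    refine ⟨ζ, hy.1.le.trans h1, ?_, ?_⟩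
    · push_cast; linarith [hy.2]
    · rw [add_sub_cancel_left, div_one] at hy'
      rw [Function.iterate_succ_apply', fwdDiff, ← hy', h3, Finset.prod_range_succ']
      push_cast
      rw [show θ - 1 - (K : ℝ) = θ - (K + 1) by ring]
      simp only [sub_add_eq_sub_sub_swap]
      simp
      ring

lemma eventually_sum_fwdDiff_iter_rpow_bounds {ι : Type*} (s : Finset ι) (α θ : ι → ℝ) (i₀ : ι)
    (hi₀ : i₀ ∈ s) (hα : ∀ i, 0 < α i) (hθ : ∀ i ∈ s, i ≠ i₀ → θ i < θ i₀) (K : ℕ)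
    (hprod : 0 < ∏ k ∈ Finset.range K, (θ i₀ - k)) (hK : θ i₀ < K) :
    ∀ᶠ X : ℝ in Filter.atTop, ∀ t : ℝ, 1 ≤ t →
      t ^ θ i₀ * X ^ (θ i₀ - K) = X ^ (-(1 / 2) : ℝ) → ∀ y : ℝ, X ≤ y → y ≤ 3 * X →
      X ^ (-(3 / 4) : ℝ) ≤
        ∑ i ∈ s, α i * t ^ θ i * (fwdDiff 1)^[K] (fun x : ℝ => x ^ θ i) y ∧
      ∑ i ∈ s, α i * t ^ θ i * (fwdDiff 1)^[K] (fun x : ℝ => x ^ θ i) y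
        ≤ X ^ (-(1 / 4) : ℝ) := by
  classical
  set B : ι → ℝ := fun i => |∏ k ∈ Finset.range K, (θ i - k)| with hB
  set c : ℝ := α i₀ * B i₀ * 4 ^ (θ i₀ - K) with hc
  have hBpos : 0 < B i₀ := abs_pos.2 hprod.ne'
  have hc0 : 0 < c := mul_pos (mul_pos (hα _) hBpos) (by positivity)
  have htail : Filter.Tendsto (fun X : ℝ => ∑ i ∈ s.erase i₀, α i * B i * X ^ (-(θ i₀ - θ i)))
      Filter.atTop (nhds 0) := by
    have : Filter.Tendsto (fun X : ℝ => ∑ i ∈ s.erase i₀, α i * B i * X ^ (-(θ i₀ - θ i)))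
      Filter.atTop (nhds (∑ i ∈ s.erase i₀, α i * B i * 0)) := by
      refine tendsto_finsetSum _ fun i hi => ?_
      have := hθ i (Finset.mem_of_mem_erase hi) (Finset.ne_of_mem_erase hi)
      exact (tendsto_rpow_neg_atTop (by linarith)).const_mul _
    simpa using this
  have hquarter := tendsto_rpow_neg_atTop (show (0 : ℝ) < 1 / 4 by norm_num)
  have hC0 : 0 < α i₀ * B i₀ + c / 2 := by have := mul_pos (hα i₀) hBpos; positivity
  filter_upwards [htail.eventually_le_const (half_pos hc0),
    hquarter.eventually_le_const (half_pos hc0),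
    hquarter.eventually_le_const (inv_pos.2 hC0),
    Filter.eventually_ge_atTop (1 : ℝ), Filter.eventually_ge_atTop (K : ℝ)]
    with X hX1 hX2 hX3 hX4 hX5 t ht htX y hy1 hy2
  have hX0 : 0 < X := by linarith
  have ht0 : 0 < t := by linarith
  have hhalf : 0 < X ^ (-(1 / 2) : ℝ) := by positivity
  have hbound : ∀ i ∈ s, i ≠ i₀ →
      |α i * t ^ θ i * (fwdDiff 1)^[K] (fun x : ℝ => x ^ θ i) y|
        ≤ (α i * B i * X ^ (-(θ i₀ - θ i))) * X ^ (-(1 / 2) : ℝ) := by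
    intro i hi hne
    have hlt := hθ i hi hne
    obtain ⟨ζ, h1, h2, h3⟩ := exists_fwdDiff_iter_rpow_eq K (θ i) (hX0.trans_le hy1)
    have hζ : 0 < ζ := by linarith
    rw [h3, abs_mul, abs_mul, abs_mul, abs_of_pos (hα i), abs_of_pos (by positivity : 0 < t ^ θ i),
      abs_of_pos (by positivity : 0 < ζ ^ (θ i - K))]
    have h4 : ζ ^ (θ i - K) ≤ X ^ (θ i - K) :=
      Real.rpow_le_rpow_of_nonpos hX0 (hy1.trans h1) (by linarith)
    have h5 : t ^ θ i ≤ t ^ θ i₀ := Real.rpow_le_rpow_of_exponent_le ht hlt.le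
    have h6 : X ^ (θ i - K) = X ^ (-(θ i₀ - θ i)) * X ^ (θ i₀ - K) := by
      rw [← Real.rpow_add hX0]; ring_nf
    have hBi : 0 ≤ B i := abs_nonneg _
    calc α i * t ^ θ i * (B i * ζ ^ (θ i - K))
        ≤ α i * t ^ θ i₀ * (B i * X ^ (θ i - K)) := by
          have := hα i
          gcongr
      _ = α i * B i * X ^ (-(θ i₀ - θ i)) * (t ^ θ i₀ * X ^ (θ i₀ - K)) := by rw [h6]; ring
      _ = _ := by rw [htX]
  have hrest : |∑ i ∈ s.erase i₀, α i * t ^ θ i * (fwdDiff 1)^[K] (fun x : ℝ => x ^ θ i) y|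
      ≤ c / 2 * X ^ (-(1 / 2) : ℝ) := by
    refine (Finset.abs_sum_le_sum_abs _ _).trans ?_
    refine (Finset.sum_le_sum fun i hi =>
      hbound i (Finset.mem_of_mem_erase hi) (Finset.ne_of_mem_erase hi)).trans ?_
    rw [← Finset.sum_mul]
    gcongr
  obtain ⟨ζ, h1, h2, h3⟩ := exists_fwdDiff_iter_rpow_eq K (θ i₀) (hX0.trans_le hy1)
  have hζ : 0 < ζ := by linarith
  have hB₀ : ∏ k ∈ Finset.range K, (θ i₀ - k) = B i₀ := (abs_of_pos hprod).symm
  have hmain1 : c * X ^ (-(1 / 2) : ℝ) ≤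
      α i₀ * t ^ θ i₀ * (fwdDiff 1)^[K] (fun x : ℝ => x ^ θ i₀) y := by
    rw [h3, hB₀]
    have h4 : (4 * X) ^ (θ i₀ - K) ≤ ζ ^ (θ i₀ - K) :=
      Real.rpow_le_rpow_of_nonpos hζ (by linarith) (by linarith)
    rw [Real.mul_rpow (by norm_num) hX0.le] at h4
    have := hα i₀
    calc c * X ^ (-(1 / 2) : ℝ)
        = α i₀ * t ^ θ i₀ * (B i₀ * (4 ^ (θ i₀ - K) * X ^ (θ i₀ - K))) := by
          rw [← htX, hc]; ring
      _ ≤ _ := by gcongr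
  have hmain2 : α i₀ * t ^ θ i₀ * (fwdDiff 1)^[K] (fun x : ℝ => x ^ θ i₀) y
      ≤ α i₀ * B i₀ * X ^ (-(1 / 2) : ℝ) := by
    rw [h3, hB₀]
    have h4 : ζ ^ (θ i₀ - K) ≤ X ^ (θ i₀ - K) :=
      Real.rpow_le_rpow_of_nonpos hX0 (hy1.trans h1) (by linarith)
    have := hα i₀
    calc α i₀ * t ^ θ i₀ * (B i₀ * ζ ^ (θ i₀ - K))
        ≤ α i₀ * t ^ θ i₀ * (B i₀ * X ^ (θ i₀ - K)) := by gcongr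
      _ = α i₀ * B i₀ * X ^ (-(1 / 2) : ℝ) := by rw [← htX]; ring
  rw [← Finset.add_sum_erase s _ hi₀]
  have hr := abs_le.1 hrest
  constructor
  · have : X ^ (-(3 / 4) : ℝ) = X ^ (-(1 / 4) : ℝ) * X ^ (-(1 / 2) : ℝ) := by
      rw [← Real.rpow_add hX0]; norm_num
    have h7 : X ^ (-(1 / 4) : ℝ) * X ^ (-(1 / 2) : ℝ) ≤ c / 2 * X ^ (-(1 / 2) : ℝ) := by gcongr
    linarith
  · have h8 : X ^ (-(1 / 2) : ℝ) = X ^ (-(1 / 4) : ℝ) * X ^ (-(1 / 4) : ℝ) := by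
      rw [← Real.rpow_add hX0]; norm_num
    have h9 : (α i₀ * B i₀ + c / 2) * X ^ (-(1 / 4) : ℝ) ≤ 1 := by
      rw [← le_div_iff₀' hC0]
      exact hX3.trans_eq (one_div _).symm
    have h10 : 0 < X ^ (-(1 / 4) : ℝ) := by positivity
    have h11 : (α i₀ * B i₀ + c / 2) * X ^ (-(1 / 2) : ℝ) ≤ X ^ (-(1 / 4) : ℝ) := by
      rw [h8, ← mul_assoc]
      nlinarith
    linarith

lemma prod_range_sub_pos_of_even {θ : ℝ} (hθ : ∀ m : ℤ, θ ≠ m) (k : ℕ) :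
    0 < ∏ i ∈ Finset.range (⌈θ⌉₊ + 2 * k), (θ - i) := by
  induction k with
  | zero =>
    refine Finset.prod_pos fun i hi => ?_
    have := Nat.lt_ceil.1 (by simpa using hi)
    linarith
  | succ k ih =>
    rw [show ⌈θ⌉₊ + 2 * (k + 1) = ⌈θ⌉₊ + 2 * k + 1 + 1 by ring, Finset.prod_range_succ,
      Finset.prod_range_succ, mul_assoc]
    refine mul_pos ih (mul_pos_of_neg_of_neg ?_ ?_) <;>
    · have h1 := Nat.le_ceil θ
      have h2 : θ < ⌈θ⌉₊ := lt_of_le_of_ne h1 (by exact_mod_cast hθ ⌈θ⌉₊)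
      push_cast
      linarith

lemma exists_scale {θ : ℝ} (hθ : 1 ≤ θ) {M t : ℝ} (hM : 2 ≤ M) {B : ℕ} (ht1 : M ≤ t)
    (ht2 : t ≤ M ^ B) : ∃ k ≤ ⌈θ * B⌉₊ + 2, ∃ X : ℝ, M ^ (1 / 3 : ℝ) ≤ X ∧ X ≤ M ∧
      t ^ θ * X ^ (θ - (⌈θ⌉₊ + 2 * k : ℕ)) = X ^ (-(1 / 2) : ℝ) := by
  have hM0 : 0 < M := by linarith
  have ht0 : 0 < t := by linarith
  have hlM : 0 < Real.log M := Real.log_pos (by linarith)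
  have hlt1 : Real.log M ≤ Real.log t := Real.log_le_log hM0 ht1
  have hlt2 : Real.log t ≤ B * Real.log M := by
    rw [← Real.log_pow]; exact Real.log_le_log ht0 ht2
  obtain ⟨u, hu⟩ : ∃ u, u = θ * Real.log t / Real.log M := ⟨_, rfl⟩
  have huM : u * Real.log M = θ * Real.log t := by rw [hu]; field_simp
  have hu1 : 1 ≤ u := by
    rw [hu, le_div_iff₀ hlM]; nlinarith
  have hu2 : u ≤ θ * B := by
    rw [hu, div_le_iff₀ hlM]; nlinarith
  have hc1 : θ ≤ ⌈θ⌉₊ := Nat.le_ceil θ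
  have hc2 : (⌈θ⌉₊ : ℝ) < θ + 1 := Nat.ceil_lt_add_one (by linarith)
  obtain ⟨k, hk⟩ : ∃ k : ℕ, k = ⌈(u - (⌈θ⌉₊ - 1 / 2 - θ)) / 2⌉₊ := ⟨_, rfl⟩
  have hk1 : (u - (⌈θ⌉₊ - 1 / 2 - θ)) / 2 ≤ k := by rw [hk]; exact Nat.le_ceil _
  have hk2 : (k : ℝ) < (u - (⌈θ⌉₊ - 1 / 2 - θ)) / 2 + 1 := by
    rw [hk]; exact Nat.ceil_lt_add_one (by linarith)
  obtain ⟨w, hw⟩ : ∃ w, w = ((⌈θ⌉₊ + 2 * k : ℕ) : ℝ) - 1 / 2 - θ := ⟨_, rfl⟩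
  have hw' := hw
  push_cast at hw'
  have hw1 : u ≤ w := by linarith
  have hw2 : w ≤ u + 2 := by linarith
  have hw0 : 0 < w := by linarith
  refine ⟨k, ?_, t ^ (θ / w), ?_, ?_, ?_⟩
  · have h1 : θ * B ≤ ⌈θ * B⌉₊ := Nat.le_ceil _
    have : (k : ℝ) ≤ ⌈θ * B⌉₊ + 2 := by linarith
    exact_mod_cast this
  · refine (Real.log_le_log_iff (by positivity) (by positivity)).1 ?_
    rw [Real.log_rpow hM0, Real.log_rpow ht0, div_mul_eq_mul_div θ w, ← huM, le_div_iff₀ hw0]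
    nlinarith
  · refine (Real.log_le_log_iff (by positivity) (by positivity)).1 ?_
    rw [Real.log_rpow ht0, div_mul_eq_mul_div, ← huM, div_le_iff₀ hw0]
    nlinarith
  · rw [← Real.rpow_mul ht0.le, ← Real.rpow_mul ht0.le, ← Real.rpow_add ht0]
    congr 1
    have : ((⌈θ⌉₊ + 2 * k : ℕ) : ℝ) = w + 1 / 2 + θ := by rw [hw]; ring
    rw [this]
    field_simp
    ring

lemma exists_close_integer_along_progression {ι : Type*} (s : Finset ι) (α θ : ι → ℝ) (i₀ : ι)
    (hi₀ : i₀ ∈ s) (hα : ∀ i, 0 < α i) (hθ : ∀ i ∈ s, i ≠ i₀ → θ i < θ i₀) (hθ1 : 1 ≤ θ i₀)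
    (hnonint : ∀ m : ℤ, θ i₀ ≠ m) (ω : ℕ → ℕ) (B : ℕ) :
    ∃ (c c₁ : ℕ) (C Y₀ : ℝ), 1 ≤ c₁ ∧ 2 ≤ Y₀ ∧ ∀ Y ξ : ℝ, Y₀ ≤ Y →
      (∀ r ≤ c, ReturnsWithin ξ Y r (ω r)) → ∀ t : ℕ, Y ^ c₁ ≤ t → (t : ℝ) ≤ (Y ^ c₁) ^ B →
      ∃ m : ℕ, 1 ≤ m ∧ m ≤ 3 * Y ^ c₁ ∧ ∃ z : ℤ,
        1 ≤ (∑ i ∈ s, α i * ((t : ℝ) * m) ^ θ i - z) * Y ∧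
        (∑ i ∈ s, α i * ((t : ℝ) * m) ^ θ i - z) * Y ≤ 3 ∧ nearestIntDist (ξ * z) * Y ≤ C := by
  obtain ⟨k₁, hk₁⟩ : ∃ k₁, k₁ = ⌈θ i₀ * B⌉₊ + 2 := ⟨_, rfl⟩
  have hceil : 1 ≤ ⌈θ i₀⌉₊ := Nat.one_le_ceil_iff.2 (by linarith)
  have hceil' : θ i₀ < ⌈θ i₀⌉₊ :=
    lt_of_le_of_ne (Nat.le_ceil _) (by exact_mod_cast hnonint ⌈θ i₀⌉₊)
  choose cK hcK using exists_close_integer_of_fwdDiff_small ω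
  obtain ⟨c, hc⟩ : ∃ c, c = (Finset.range (k₁ + 1)).sup fun k => cK (⌈θ i₀⌉₊ + 2 * k - 1) :=
    ⟨_, rfl⟩
  have hcle : ∀ k ≤ k₁, cK (⌈θ i₀⌉₊ + 2 * k - 1) ≤ c := fun k hk => by
    rw [hc]
    exact Finset.le_sup (f := fun k => cK (⌈θ i₀⌉₊ + 2 * k - 1)) (by simpa using by omega)
  have hev : ∀ᶠ X : ℝ in Filter.atTop, ∀ k ∈ Finset.range (k₁ + 1), _ :=
    (Filter.eventually_all_finset _).2 fun k _ =>
      eventually_sum_fwdDiff_iter_rpow_bounds s α θ i₀ hi₀ hα hθ (⌈θ i₀⌉₊ + 2 * k)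
        (prod_range_sub_pos_of_even hnonint k) (by push_cast; linarith)
  obtain ⟨X₁, hX₁⟩ := Filter.eventually_atTop.1 hev
  refine ⟨c, 12 * (c + 1), (⌈θ i₀⌉₊ + 2 * k₁ : ℕ), max 2 X₁, by omega, le_max_left _ _,
    fun Y ξ hY hret t ht1 ht2 => ?_⟩
  have hY2 : 2 ≤ Y := (le_max_left _ _).trans hY
  have hY1 : 1 ≤ Y := by linarith
  have hY0 : 0 < Y := by linarith
  obtain ⟨k, hk, X, hX1, hX2, hX3⟩ := exists_scale hθ1
    (hY2.trans (le_self_pow₀ hY1 (by omega : 12 * (c + 1) ≠ 0))) ht1 ht2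
  rw [← hk₁] at hk
  have hXY : Y ^ (4 * (c + 1)) ≤ X := by
    refine le_trans (le_of_eq ?_) hX1
    rw [← Real.rpow_natCast, ← Real.rpow_natCast, ← Real.rpow_mul hY0.le]
    congr 1
    push_cast
    ring
  have hXY1 : Y ≤ X := (le_self_pow₀ hY1 (by omega)).trans hXY
  have hX0 : 0 < X := by linarith
  have ht0 : (1 : ℝ) ≤ t := (one_le_pow₀ hY1).trans ht1
  have hbd := hX₁ X (((le_max_right _ _).trans hY).trans hXY1) k (by simpa using by omega) t ht0 hX3
  set K := ⌈θ i₀⌉₊ + 2 * k with hK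
  have hK1 : K - 1 + 1 = K := by omega
  have hup : (⌈X⌉₊ : ℝ) < X + 1 := Nat.ceil_lt_add_one hX0.le
  have hlo : X ≤ ⌈X⌉₊ := Nat.le_ceil _
  have hfl : (⌊X⌋₊ : ℝ) ≤ X := Nat.floor_le hX0.le
  have hfl' : X < ⌊X⌋₊ + 1 := Nat.lt_floor_add_one X
  obtain ⟨G, hG⟩ : ∃ G : ℕ → ℝ,
    G = fun h : ℕ => ∑ i ∈ s, α i * ((t : ℝ) * ((⌈X⌉₊ : ℝ) + h)) ^ θ i := ⟨_, rfl⟩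
  have hGd : ∀ h : ℕ, (fwdDiff 1)^[K] G h =
      ∑ i ∈ s, α i * (t : ℝ) ^ θ i * (fwdDiff 1)^[K] (fun x : ℝ => x ^ θ i) (⌈X⌉₊ + h) := by
    intro h
    have : G = ∑ i ∈ s, (α i * (t : ℝ) ^ θ i) •
        fun h : ℕ => (fun x : ℝ => x ^ θ i) ((⌈X⌉₊ : ℝ) + h) := by
      ext h
      rw [hG, Finset.sum_apply]
      refine Finset.sum_congr rfl fun i _ => ?_
      rw [Real.mul_rpow (by positivity) (by positivity)]
      simp [mul_assoc]
    rw [this, fwdDiff_iter_finsetSum, Finset.sum_apply]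
    refine Finset.sum_congr rfl fun i _ => ?_
    rw [fwdDiff_iter_const_smul, Pi.smul_apply, smul_eq_mul]
    exact congrArg _ (fwdDiff_iter_natCast_add (fun x : ℝ => x ^ θ i) _ K h)
  have hquarter : Y ^ (c + 1) ≤ X ^ (1 / 4 : ℝ) := by
    have := Real.rpow_le_rpow (by positivity) hXY (show (0 : ℝ) ≤ 1 / 4 by norm_num)
    refine le_trans (le_of_eq ?_) this
    rw [← Real.rpow_natCast, ← Real.rpow_natCast, ← Real.rpow_mul hY0.le]
    congr 1
    push_cast
    ring
  have hcK' : Y ^ cK (K - 1) ≤ Y ^ c := pow_le_pow_right₀ hY1 (hcle k hk)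
  obtain ⟨h, hh, z, hz1, hz2, hz3⟩ := hcK (K - 1) Y ξ hY2
    (fun r hr => hret r (hr.trans (hcle k hk))) G (X ^ (-(3 / 4) : ℝ)) (X ^ (-(1 / 4) : ℝ)) ⌊X⌋₊
    (by positivity) (by
      intro h hh
      rw [hK1, hGd]
      have : (h : ℝ) ≤ ⌊X⌋₊ := by exact_mod_cast hh
      have h0 : (0 : ℝ) ≤ h := Nat.cast_nonneg h
      exact hbd _ (by linarith) (by linarith)) (by
      rw [Real.rpow_neg hX0.le, inv_mul_le_iff₀ (by positivity), mul_one]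
      exact hcK'.trans ((pow_le_pow_right₀ hY1 (by omega)).trans hquarter)) (by
      have h1 : X / 2 ≤ ⌊X⌋₊ := by linarith
      have h2 : X ^ (-(3 / 4) : ℝ) * X = X ^ (1 / 4 : ℝ) := by
        rw [← Real.rpow_add_one hX0.ne']; norm_num
      calc Y ^ cK (K - 1) ≤ Y ^ c := hcK'
        _ ≤ Y ^ (c + 1) / 2 := by
          rw [pow_succ]
          have : 0 < Y ^ c := by positivity
          nlinarith
        _ ≤ X ^ (1 / 4 : ℝ) / 2 := by gcongr
        _ = X ^ (-(3 / 4) : ℝ) * (X / 2) := by rw [← h2]; ring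
        _ ≤ _ := by gcongr)
  have hhX : (h : ℝ) ≤ ⌊X⌋₊ := by exact_mod_cast hh
  refine ⟨⌈X⌉₊ + h, ?_, ?_, z, ?_, ?_, hz3.trans ?_⟩
  · have : 1 ≤ ⌈X⌉₊ := Nat.one_le_ceil_iff.2 hX0
    omega
  · push_cast; linarith
  · rw [hG] at hz1; push_cast; exact hz1
  · rw [hG] at hz2; push_cast; exact hz2
  · have : K - 1 + 1 ≤ ⌈θ i₀⌉₊ + 2 * k₁ := by omega
    exact_mod_cast this

lemma nearestIntDist_mul_pow_mul_pow_le {β M : ℝ} {t T m j D : ℕ} (hM : 6 ≤ M) (hT : T ≤ 2 * M)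
    (hm : m ≤ 3 * M) (hj : j ≤ D) (h : nearestIntDist (β * t ^ j) * M ^ (3 * D + 3) ≤ 1) :
    nearestIntDist (β * ((t * T : ℕ) : ℝ) ^ j) * m ^ j * M ^ 3 ≤ 1 := by
  have hM1 : 1 ≤ M := by linarith
  have h1 : nearestIntDist (β * ((t * T : ℕ) : ℝ) ^ j) ≤ T ^ j * nearestIntDist (β * t ^ j) := by
    have := nearestIntDist_natCast_mul_le (T ^ j) (β * t ^ j)
    rw [show ((T ^ j : ℕ) : ℝ) * (β * t ^ j) = β * ((t * T : ℕ) : ℝ) ^ j by push_cast; ring] at this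
    exact_mod_cast this
  have h2 : (T : ℝ) ^ j * m ^ j ≤ M ^ (3 * D) := by
    rw [← mul_pow]
    calc ((T : ℝ) * m) ^ j ≤ (2 * M * (3 * M)) ^ j := by gcongr
      _ ≤ (M ^ 3) ^ j := by
        gcongr
        nlinarith [sq_nonneg M]
      _ = M ^ (3 * j) := by rw [pow_mul]
      _ ≤ M ^ (3 * D) := pow_le_pow_right₀ hM1 (by omega)
  have h3 := nearestIntDist_nonneg (β * t ^ j)
  calc nearestIntDist (β * ((t * T : ℕ) : ℝ) ^ j) * m ^ j * M ^ 3
      ≤ T ^ j * nearestIntDist (β * t ^ j) * m ^ j * M ^ 3 := by gcongr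
    _ = nearestIntDist (β * t ^ j) * (T ^ j * m ^ j) * M ^ 3 := by ring
    _ ≤ nearestIntDist (β * t ^ j) * M ^ (3 * D) * M ^ 3 := by gcongr
    _ = nearestIntDist (β * t ^ j) * M ^ (3 * D + 3) := by ring
    _ ≤ 1 := h

set_option maxHeartbeats 1000000 in
lemma exists_floor_close_of_returnsWithin {d : ℕ} {α θ : Fin (d + 1) → ℝ} (hα : ∀ i, 0 < α i)
    (hθ1 : ∀ i, 1 ≤ θ i) (hmono : StrictMono θ) (hnon : ∃ i, ∀ m : ℤ, θ i ≠ (m : ℝ))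
    (ω : ℕ → ℕ) : ∃ (c e : ℕ) (C Y₀ : ℝ), 2 ≤ Y₀ ∧ ∀ Y ξ : ℝ, Y₀ ≤ Y → |ξ| ≤ 1 →
      (∀ r ≤ c, ReturnsWithin ξ Y r (ω r)) → ∃ n : ℕ, 1 ≤ n ∧ n ≤ Y ^ e ∧
      nearestIntDist (ξ * (⌊∑ i, α i * (n : ℝ) ^ θ i⌋ : ℝ)) * Y ≤ C := by
  classical
  set s : Finset (Fin (d + 1)) := Finset.univ.filter fun i => ∀ m : ℤ, θ i ≠ (m : ℝ) with hs
  have hsne : s.Nonempty := by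
    obtain ⟨i, hi⟩ := hnon
    exact ⟨i, by simp [hs, hi]⟩
  obtain ⟨i₀, hi₀s, hi₀⟩ := s.exists_max_image id hsne
  have hi₀non : ∀ m : ℤ, θ i₀ ≠ (m : ℝ) := (Finset.mem_filter.1 hi₀s).2
  set j : Fin (d + 1) → ℕ := fun i => ⌊θ i⌋₊ with hj
  have hj1 : ∀ i, 1 ≤ j i := fun i => (Nat.one_le_floor_iff _).2 (hθ1 i)
  have hjθ : ∀ i ∈ sᶜ, θ i = j i := by
    intro i hi
    have : ∃ m : ℤ, θ i = m := by simpa [hs] using hi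
    obtain ⟨m, hm⟩ := this
    have hm0 : 0 ≤ m := by
      have := hθ1 i
      rw [hm] at this
      exact_mod_cast zero_le_one.trans this
    lift m to ℕ using hm0
    simp only [hj, hm]
    simp
  obtain ⟨c₂, hc₂⟩ := exists_nearestIntDist_mul_pow_le_finset
    (fun p : Fin (d + 1) × Bool => j p.1) (fun p => hj1 p.1) Finset.univ
  set D := Finset.univ.sup j with hD
  have hjD : ∀ i, j i ≤ D := fun i => Finset.le_sup (f := j) (Finset.mem_univ i)
  obtain ⟨B, hB⟩ : ∃ B, B = (3 * D + 3) * c₂ + 2 := ⟨_, rfl⟩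
  obtain ⟨c, c₁, C, Y₀, hc₁, hY₀, hmain⟩ := exists_close_integer_along_progression s α θ i₀ hi₀s hα
    (fun i hi hne => hmono (lt_of_le_of_ne (hi₀ i hi) hne)) (hθ1 i₀) hi₀non ω B
  refine ⟨c, c₁ * (B + 2), C + 1, max Y₀ (max 6 (2 * (d + 1))), hY₀.trans (le_max_left _ _),
    fun Y ξ hY hξ hret => ?_⟩
  have hYY₀ : Y₀ ≤ Y := (le_max_left _ _).trans hY
  have hY6 : 6 ≤ Y := (le_max_left _ _).trans ((le_max_right _ _).trans hY)
  have hYd : 2 * ((d : ℝ) + 1) ≤ Y := (le_max_right _ _).trans ((le_max_right _ _).trans hY)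
  have hY1 : 1 ≤ Y := by linarith
  have hY0 : 0 < Y := by linarith
  set M := Y ^ c₁ with hM
  have hYM : Y ≤ M := le_self_pow₀ hY1 (by omega)
  have hM6 : 6 ≤ M := hY6.trans hYM
  have hM1 : 1 ≤ M := by linarith
  obtain ⟨t₀, ht1, ht2, ht3⟩ := hc₂ (M ^ (3 * D + 3))
    ((by linarith : 2 ≤ M).trans (le_self_pow₀ hM1 (by omega)))
    (fun p => if p.2 then ξ * α p.1 else α p.1)
  have htα : ∀ i, nearestIntDist (α i * t₀ ^ j i) * M ^ (3 * D + 3) ≤ 1 := fun i => by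
    simpa using ht3 (i, false) (Finset.mem_univ _)
  have htξ : ∀ i, nearestIntDist (ξ * α i * t₀ ^ j i) * M ^ (3 * D + 3) ≤ 1 := fun i => by
    simpa using ht3 (i, true) (Finset.mem_univ _)
  set T := ⌈M⌉₊ with hT
  have hT1 : M ≤ T := Nat.le_ceil _
  have hT2 : (T : ℝ) ≤ 2 * M := by
    have : (T : ℝ) < M + 1 := Nat.ceil_lt_add_one (by linarith)
    linarith
  have ht₀1 : (1 : ℝ) ≤ t₀ := by exact_mod_cast ht1
  have htM : M ≤ ((t₀ * T : ℕ) : ℝ) := by push_cast; nlinarith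
  have htB : ((t₀ * T : ℕ) : ℝ) ≤ M ^ B := by
    push_cast
    calc (t₀ : ℝ) * T ≤ (M ^ (3 * D + 3)) ^ c₂ * M ^ 2 := by
          gcongr
          nlinarith
      _ = M ^ B := by rw [hB, ← pow_mul, ← pow_add]
  obtain ⟨m, hm1, hm2, z, hz1, hz2, hz3⟩ := hmain Y ξ hYY₀ hret (t₀ * T) htM htB
  set t := t₀ * T with ht
  have hYM3 : Y * (2 * (d + 1)) ≤ M ^ 3 := by
    have : Y * (2 * (d + 1)) ≤ M * M := by gcongr; linarith
    nlinarith
  have hd0 : (0 : ℝ) < d + 1 := by positivity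
  have hscale : ∀ x : ℝ, 0 ≤ x → x * M ^ 3 ≤ 1 → x * Y ≤ 1 / (2 * (d + 1)) := by
    intro x hx h
    rw [le_div_iff₀ (by positivity)]
    have := mul_le_mul_of_nonneg_left hYM3 hx
    linarith
  set σ : Fin (d + 1) → ℤ := fun i => round (α i * (t : ℝ) ^ j i) with hσ
  set ε : Fin (d + 1) → ℝ := fun i => α i * (t : ℝ) ^ j i - σ i with hε
  have hε1 : ∀ i, |ε i| * m ^ j i * Y ≤ 1 / (2 * (d + 1)) := fun i =>
    hscale _ (by positivity) (nearestIntDist_mul_pow_mul_pow_le hM6 hT2 hm2 (hjD i) (htα i))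
  have hξ1 : ∀ i, nearestIntDist (ξ * α i * (t : ℝ) ^ j i) * m ^ j i * Y ≤ 1 / (2 * (d + 1)) :=
    fun i => hscale _ (mul_nonneg (nearestIntDist_nonneg _) (by positivity))
      (nearestIntDist_mul_pow_mul_pow_le hM6 hT2 hm2 (hjD i) (htξ i))
  have hσ1 : ∀ i, nearestIntDist (ξ * ((σ i : ℝ) * m ^ j i)) * Y ≤ 1 / (d + 1) := by
    intro i
    have h1 : nearestIntDist (ξ * ((σ i : ℝ) * m ^ j i)) ≤ m ^ j i * nearestIntDist (ξ * σ i) := by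
      have := nearestIntDist_natCast_mul_le (m ^ j i) (ξ * σ i)
      rw [show ((m ^ j i : ℕ) : ℝ) * (ξ * σ i) = ξ * ((σ i : ℝ) * m ^ j i) by
        push_cast; ring] at this
      exact_mod_cast this
    have h2 : nearestIntDist (ξ * σ i) ≤ nearestIntDist (ξ * α i * (t : ℝ) ^ j i) + |ε i| := by
      have h3 := nearestIntDist_add_le (ξ * α i * (t : ℝ) ^ j i) (-(ξ * ε i))
      rw [show ξ * α i * (t : ℝ) ^ j i + -(ξ * ε i) = ξ * σ i by simp only [hε]; ring] at h3
      have h4 := nearestIntDist_le_abs (-(ξ * ε i))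
      rw [abs_neg, abs_mul] at h4
      have h5 : |ξ| * |ε i| ≤ 1 * |ε i| := by gcongr
      linarith
    calc nearestIntDist (ξ * ((σ i : ℝ) * m ^ j i)) * Y
        ≤ m ^ j i * (nearestIntDist (ξ * α i * (t : ℝ) ^ j i) + |ε i|) * Y := by
          gcongr
          exact h1.trans (by gcongr)
      _ = nearestIntDist (ξ * α i * (t : ℝ) ^ j i) * m ^ j i * Y + |ε i| * m ^ j i * Y := by ring
      _ ≤ 1 / (2 * (d + 1)) + 1 / (2 * (d + 1)) := add_le_add (hξ1 i) (hε1 i)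
      _ = 1 / (d + 1) := by field_simp; norm_num
  have hcard : ((sᶜ).card : ℝ) ≤ d + 1 := by
    have := Finset.card_le_univ sᶜ
    rw [Fintype.card_fin] at this
    exact_mod_cast this
  have hεsum : |∑ i ∈ sᶜ, ε i * m ^ j i| * Y ≤ 1 / 2 := by
    calc |∑ i ∈ sᶜ, ε i * m ^ j i| * Y ≤ (∑ i ∈ sᶜ, |ε i * m ^ j i|) * Y := by
          gcongr
          exact Finset.abs_sum_le_sum_abs _ _
      _ = ∑ i ∈ sᶜ, |ε i| * m ^ j i * Y := by
          rw [Finset.sum_mul]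
          refine Finset.sum_congr rfl fun i _ => ?_
          rw [abs_mul, abs_of_nonneg (by positivity : (0 : ℝ) ≤ m ^ j i)]
      _ ≤ (sᶜ).card • (1 / (2 * ((d : ℝ) + 1))) := Finset.sum_le_card_nsmul _ _ _ fun i _ => hε1 i
      _ ≤ (d + 1) * (1 / (2 * ((d : ℝ) + 1))) := by
          rw [nsmul_eq_mul]; gcongr
      _ = 1 / 2 := by field_simp
  set z' : ℤ := z + ∑ i ∈ sᶜ, σ i * (m : ℤ) ^ j i with hz'
  have hz'R : (z' : ℝ) = z + ∑ i ∈ sᶜ, (σ i : ℝ) * m ^ j i := by rw [hz']; push_cast; rfl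
  have hf : ∑ i, α i * ((t * m : ℕ) : ℝ) ^ θ i = (∑ i ∈ s, α i * ((t : ℝ) * m) ^ θ i - z)
      + ∑ i ∈ sᶜ, ε i * m ^ j i + z' := by
    rw [← Finset.sum_add_sum_compl s, hz'R]
    have h1 : ∑ i ∈ sᶜ, α i * ((t * m : ℕ) : ℝ) ^ θ i
        = ∑ i ∈ sᶜ, ε i * m ^ j i + ∑ i ∈ sᶜ, (σ i : ℝ) * m ^ j i := by
      rw [← Finset.sum_add_distrib]
      refine Finset.sum_congr rfl fun i hi => ?_
      rw [hjθ i hi, Real.rpow_natCast]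
      simp only [hε]
      push_cast
      ring
    rw [h1]
    push_cast
    ring
  have hfloor : ⌊∑ i, α i * ((t * m : ℕ) : ℝ) ^ θ i⌋ = z' := by
    rw [hf, Int.floor_add_intCast, add_eq_right, Int.floor_eq_zero_iff]
    obtain ⟨x, hx⟩ : ∃ x, x = ∑ i ∈ sᶜ, ε i * m ^ j i := ⟨_, rfl⟩
    rw [← hx] at hεsum ⊢
    have h1 : -(1 / 2) ≤ x * Y := by nlinarith [neg_abs_le x]
    have h2 : x * Y ≤ 1 / 2 := by nlinarith [le_abs_self x]
    constructor
    · refine le_of_mul_le_mul_right ?_ hY0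
      rw [add_mul]; linarith
    · refine lt_of_mul_lt_mul_right ?_ hY0.le
      rw [add_mul]; linarith
  refine ⟨t * m, ?_, ?_, ?_⟩
  · have : 1 ≤ T := Nat.one_le_ceil_iff.2 (by linarith)
    exact Nat.mul_pos (Nat.mul_pos ht1 this) hm1
  · push_cast
    calc (t : ℝ) * m ≤ M ^ B * M ^ 2 := by
          gcongr
          nlinarith
      _ = Y ^ (c₁ * (B + 2)) := by rw [← pow_add, hM, ← pow_mul]
  · rw [hfloor, hz'R, mul_add, Finset.mul_sum]
    have h1 := nearestIntDist_add_le (ξ * z) (∑ i ∈ sᶜ, ξ * ((σ i : ℝ) * m ^ j i))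
    have h2 := nearestIntDist_sum_le sᶜ fun i => ξ * ((σ i : ℝ) * m ^ j i)
    have h3 : (∑ i ∈ sᶜ, nearestIntDist (ξ * ((σ i : ℝ) * m ^ j i))) * Y ≤ 1 := by
      rw [Finset.sum_mul]
      calc ∑ i ∈ sᶜ, nearestIntDist (ξ * ((σ i : ℝ) * m ^ j i)) * Y
          ≤ (sᶜ).card • (1 / ((d : ℝ) + 1)) := Finset.sum_le_card_nsmul _ _ _ fun i _ => hσ1 i
        _ ≤ (d + 1) * (1 / ((d : ℝ) + 1)) := by rw [nsmul_eq_mul]; gcongr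
        _ = 1 := by field_simp
    have h4 := mul_le_mul_of_nonneg_right (h1.trans (add_le_add_right h2 _)) hY0.le
    rw [add_mul] at h4
    linarith

lemma nearestIntDist_fract_mul_intCast (ξ : ℝ) (z : ℤ) :
    nearestIntDist (Int.fract ξ * z) = nearestIntDist (ξ * z) := by
  have h : ξ * z = Int.fract ξ * z + ((⌊ξ⌋ * z : ℤ) : ℝ) := by
    rw [Int.fract]; push_cast; ring
  rw [h, nearestIntDist_add_intCast]

lemma returnsWithin_fract {ξ Y : ℝ} {r l : ℕ} (h : ReturnsWithin ξ Y r l) :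
    ReturnsWithin (Int.fract ξ) Y r l := by
  intro x
  obtain ⟨s, h1, h2, h3⟩ := h x
  exact ⟨s, h1, h2, by rwa [nearestIntDist_fract_mul_intCast]⟩

lemma returnsWithin_of_den_le {q : ℚ} {Y : ℝ} (hq : q.den ≤ Y) (r : ℕ) :
    ReturnsWithin q Y r 1 := by
  intro x
  have hden : (0 : ℝ) < q.den := by exact_mod_cast q.den_pos
  refine ⟨q.den * ⌈x / q.den⌉, ?_, ?_, ?_⟩
  · have := Int.le_ceil (x / q.den)
    rw [div_le_iff₀ hden] at this
    push_cast
    linarith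
  · have := (Int.ceil_lt_add_one (x / q.den)).le
    have h2 := mul_le_mul_of_nonneg_left this hden.le
    have h3 : (q.den : ℝ) * (x / q.den) = x := by field_simp
    push_cast
    rw [pow_one]
    rw [mul_add, h3] at h2
    linarith
  · have h1 : (q : ℝ) * ((q.den * ⌈x / q.den⌉ : ℤ) : ℝ) = ((q.num * ⌈x / q.den⌉ : ℤ) : ℝ) := by
      have : (q : ℝ) * q.den = q.num := by exact_mod_cast Rat.mul_den_eq_num q
      push_cast
      rw [← mul_assoc, this]
    have h2 := nearestIntDist_le ((q.num * ⌈x / q.den⌉ : ℤ) : ℝ) (q.num * ⌈x / q.den⌉)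
    rw [sub_self, abs_zero] at h2
    rw [h1, le_antisymm h2 (nearestIntDist_nonneg _)]
    simp

lemma exists_intCast_mul_num_congr (q : ℚ) (b : ℤ) :
    ∃ u k : ℤ, 0 ≤ u ∧ u < q.den ∧ u * q.num = b + k * q.den := by
  obtain ⟨x, y, hxy⟩ := Rat.isCoprime_num_den q
  have hden : (0 : ℤ) < q.den := by exact_mod_cast q.den_pos
  refine ⟨(b * x) % q.den, -(b * y) - (b * x) / q.den * q.num, Int.emod_nonneg _ hden.ne',
    Int.emod_lt_of_pos _ hden, ?_⟩
  have := Int.emod_add_mul_ediv (b * x) q.den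
  linear_combination q.num * this + b * hxy

lemma returnsWithin_of_le_den {ξ Y : ℝ} {q : ℚ} {r l Q : ℕ} (hY : 0 < Y)
    (hξ : |ξ - q| ≤ 1 / ((Q + 1) * q.den)) (hq1 : 2 * Y ^ r ≤ q.den) (hq2 : q.den ≤ Q)
    (hQ : Q ≤ Y ^ l) : ReturnsWithin ξ Y r l := by
  intro x
  have hden : (0 : ℝ) < q.den := by exact_mod_cast q.den_pos
  obtain ⟨u, k, hu0, hu1, huk⟩ := exists_intCast_mul_num_congr q (-⌊q.den * (ξ * ⌈x⌉)⌋)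
  have hu0' : (0 : ℝ) ≤ u := by exact_mod_cast hu0
  have hu1' : (u : ℝ) + 1 ≤ q.den := by exact_mod_cast hu1
  have hq2' : (q.den : ℝ) ≤ Q := by exact_mod_cast hq2
  refine ⟨⌈x⌉ + u, ?_, ?_, ?_⟩
  · have := Int.le_ceil x
    push_cast; linarith
  · have := Int.ceil_lt_add_one x
    push_cast; linarith
  · have huk' : (u : ℝ) * q = -⌊q.den * (ξ * ⌈x⌉)⌋ / q.den + k := by
      have h1 : (q : ℝ) * q.den = q.num := by exact_mod_cast Rat.mul_den_eq_num q
      have h2 : (u : ℝ) * q.num = -⌊q.den * (ξ * ⌈x⌉)⌋ + k * q.den := by exact_mod_cast huk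
      field_simp
      rw [mul_assoc, h1, h2]
      ring_nf
    have h3 : nearestIntDist (ξ * ((⌈x⌉ + u : ℤ) : ℝ)) ≤
        |(q.den * (ξ * ⌈x⌉) - ⌊q.den * (ξ * ⌈x⌉)⌋) / q.den + u * (ξ - q)| := by
      refine (nearestIntDist_le _ k).trans (le_of_eq ?_)
      congr 1
      rw [mul_sub, huk']
      push_cast
      field_simp
      ring_nf
    have h4 : |((q.den : ℝ) * (ξ * ⌈x⌉) - ⌊q.den * (ξ * ⌈x⌉)⌋) / q.den| ≤ 1 / q.den := by
      rw [abs_div, abs_of_pos hden]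
      gcongr
      rw [abs_le]
      constructor
      · linarith [Int.floor_le ((q.den : ℝ) * (ξ * ⌈x⌉))]
      · linarith [Int.lt_floor_add_one ((q.den : ℝ) * (ξ * ⌈x⌉))]
    have h5 : |(u : ℝ) * (ξ - q)| ≤ 1 / q.den := by
      rw [abs_mul, abs_of_nonneg hu0']
      calc (u : ℝ) * |ξ - q| ≤ q.den * (1 / ((Q + 1) * q.den)) := by gcongr; linarith
        _ = 1 / (Q + 1) := by field_simp
        _ ≤ 1 / q.den := by gcongr; linarith
    have h6 := h3.trans (abs_add_le _ _)
    calc nearestIntDist (ξ * ((⌈x⌉ + u : ℤ) : ℝ)) * Y ^ r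
        ≤ (2 / q.den) * Y ^ r := by
          gcongr
          refine h6.trans ((add_le_add h4 h5).trans (le_of_eq ?_))
          ring
      _ ≤ 1 := by
          rw [div_mul_eq_mul_div]
          exact (div_le_one hden).2 hq1

lemma exists_sum_rpow_le_pow {d : ℕ} {α θ : Fin (d + 1) → ℝ} (hα : ∀ i, 0 < α i) :
    ∃ (A : ℝ) (L : ℕ), ∀ n : ℕ, 1 ≤ n →
      0 ≤ ∑ i, α i * (n : ℝ) ^ θ i ∧ ∑ i, α i * (n : ℝ) ^ θ i ≤ A * (n : ℝ) ^ L := by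
  refine ⟨∑ i, α i, Finset.univ.sup fun i => ⌈θ i⌉₊, fun n hn => ⟨?_, ?_⟩⟩
  · exact Finset.sum_nonneg fun i _ => mul_nonneg (hα i).le (by positivity)
  · rw [Finset.sum_mul]
    refine Finset.sum_le_sum fun i _ => ?_
    have hn1 : (1 : ℝ) ≤ n := by exact_mod_cast hn
    have := (hα i).le
    gcongr
    rw [← Real.rpow_natCast]
    refine Real.rpow_le_rpow_of_exponent_le hn1 ((Nat.le_ceil _).trans ?_)
    exact_mod_cast Finset.le_sup (f := fun i => ⌈θ i⌉₊) (Finset.mem_univ i)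

lemma exists_floor_close_of_near_rational {f : ℝ → ℝ} (hf : IsPseudoPoly f) :
    ∃ (e e' : ℕ) (C Y₀ : ℝ), 2 ≤ Y₀ ∧ ∀ (Y ξ : ℝ) (q : ℚ), Y₀ ≤ Y → q.den ≤ Y →
      |ξ - q| * Y ^ e' ≤ 1 → ∃ n : ℕ, 1 ≤ n ∧ n ≤ Y ^ e ∧
        nearestIntDist (ξ * (⌊f n⌋ : ℝ)) * Y ≤ C := by
  obtain ⟨d, α, θ, hα, hθ, hmono, hnon, hfsum⟩ := hf
  obtain ⟨c, e, C, Y₀, hY₀, hmain⟩ := exists_floor_close_of_returnsWithin hα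
    (fun i => hθ.trans (hmono.monotone (Fin.zero_le i))) hmono hnon fun _ => 1
  obtain ⟨A, L, hA⟩ := exists_sum_rpow_le_pow (θ := θ) hα
  refine ⟨e, e * L + 2, C + 1, max Y₀ A, hY₀.trans (le_max_left _ _),
    fun Y ξ q hY hq hξ => ?_⟩
  have hYA : A ≤ Y := (le_max_right _ _).trans hY
  have hYY₀ : Y₀ ≤ Y := (le_max_left _ _).trans hY
  have hY0 : 0 < Y := by linarith
  obtain ⟨n, hn1, hn2, hn3⟩ := hmain Y (Int.fract (q : ℝ)) hYY₀
    (abs_le.2 ⟨by linarith [Int.fract_nonneg (q : ℝ)], (Int.fract_lt_one _).le⟩)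
    (fun r _ => returnsWithin_fract (returnsWithin_of_den_le hq r))
  refine ⟨n, hn1, hn2, ?_⟩
  rw [← hfsum, nearestIntDist_fract_mul_intCast] at hn3
  obtain ⟨hf0, hfA⟩ := hA n hn1
  rw [← hfsum] at hf0 hfA
  have hfY : f n ≤ Y ^ (e * L + 1) := by
    calc f n ≤ A * (n : ℝ) ^ L := hfA
      _ ≤ Y * (Y ^ e) ^ L := by gcongr
      _ = Y ^ (e * L + 1) := by rw [← pow_mul, pow_succ, mul_comm]
  have hfl0 : (0 : ℝ) ≤ ⌊f n⌋ := by exact_mod_cast Int.floor_nonneg.2 hf0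
  have h1 := nearestIntDist_add_le ((q : ℝ) * ⌊f n⌋) ((ξ - q) * ⌊f n⌋)
  rw [show (q : ℝ) * ⌊f n⌋ + (ξ - q) * ⌊f n⌋ = ξ * ⌊f n⌋ by ring] at h1
  have h2 := nearestIntDist_le_abs ((ξ - q) * ⌊f n⌋)
  rw [abs_mul, abs_of_nonneg hfl0] at h2
  have h3 : |ξ - q| * ⌊f n⌋ * Y ≤ 1 := by
    calc |ξ - q| * ⌊f n⌋ * Y ≤ |ξ - q| * Y ^ (e * L + 1) * Y := by
          gcongr
          exact (Int.floor_le _).trans hfY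
      _ = |ξ - q| * Y ^ (e * L + 2) := by ring
      _ ≤ 1 := hξ
  have h4 := mul_le_mul_of_nonneg_right (h1.trans (add_le_add_right h2 _)) hY0.le
  rw [add_mul] at h4
  linarith

lemma exists_floor_close {f : ℝ → ℝ} (hf : IsPseudoPoly f) :
    ∃ (e : ℕ) (C Y₀ : ℝ), 2 ≤ Y₀ ∧ ∀ Y ξ : ℝ, Y₀ ≤ Y → ∃ n : ℕ, 1 ≤ n ∧ n ≤ Y ^ e ∧
      nearestIntDist (ξ * (⌊f n⌋ : ℝ)) * Y ≤ C := by
  obtain ⟨e₁, e', C₁, Y₁, hY₁, hrat⟩ := exists_floor_close_of_near_rational hf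
  obtain ⟨d, α, θ, hα, hθ, hmono, hnon, hfsum⟩ := hf
  obtain ⟨c, e₂, C₂, Y₂, hY₂, hret⟩ := exists_floor_close_of_returnsWithin hα
    (fun i => hθ.trans (hmono.monotone (Fin.zero_le i))) hmono hnon fun r => (r + 1) * (e' + 1)
  refine ⟨e₂ + (c + 1) * e₁, max C₁ C₂, max Y₁ Y₂, hY₁.trans (le_max_left _ _),
    fun Y ξ hY => ?_⟩
  have hYY₁ : Y₁ ≤ Y := (le_max_left _ _).trans hY
  have hYY₂ : Y₂ ≤ Y := (le_max_right _ _).trans hY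
  have hY2 : 2 ≤ Y := hY₁.trans hYY₁
  have hY1 : 1 ≤ Y := by linarith
  have hY0 : 0 < Y := by linarith
  by_cases hall : ∀ r ≤ c, ReturnsWithin ξ Y r ((r + 1) * (e' + 1))
  · obtain ⟨n, hn1, hn2, hn3⟩ := hret Y (Int.fract ξ) hYY₂
      (abs_le.2 ⟨by linarith [Int.fract_nonneg ξ], (Int.fract_lt_one _).le⟩)
      (fun r hr => returnsWithin_fract (hall r hr))
    rw [← hfsum, nearestIntDist_fract_mul_intCast] at hn3
    exact ⟨n, hn1, hn2.trans (pow_le_pow_right₀ hY1 (Nat.le_add_right _ _)),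
      hn3.trans (le_max_right _ _)⟩
  · push Not at hall
    obtain ⟨r, hr, hnot⟩ := hall
    have hpow : 1 ≤ Y ^ ((r + 1) * (e' + 1)) := one_le_pow₀ hY1
    obtain ⟨q, hq1, hq2⟩ := Real.exists_rat_abs_sub_le_and_den_le ξ
      (n := ⌊Y ^ ((r + 1) * (e' + 1))⌋₊) (Nat.floor_pos.2 hpow)
    have hden : (1 : ℝ) ≤ q.den := by exact_mod_cast q.den_pos
    have hsmall : (q.den : ℝ) < 2 * Y ^ r := by
      by_contra! h
      exact hnot (returnsWithin_of_le_den hY0 hq1 h hq2 (Nat.floor_le (by positivity)))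
    have hξ : |ξ - q| ≤ 1 / Y ^ ((r + 1) * (e' + 1)) := by
      refine hq1.trans ?_
      have h1 := (Nat.lt_floor_add_one (Y ^ ((r + 1) * (e' + 1)))).le
      gcongr
      nlinarith
    obtain ⟨n, hn1, hn2, hn3⟩ := hrat (Y ^ (r + 1)) ξ q
      (hYY₁.trans (le_self_pow₀ hY1 (by omega))) (by rw [pow_succ]; nlinarith [pow_pos hY0 r]) (by
        rw [← pow_mul, ← le_div_iff₀ (by positivity)]
        refine hξ.trans ?_
        gcongr
        omega)
    refine ⟨n, hn1, ?_, ?_⟩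
    · rw [← pow_mul] at hn2
      refine hn2.trans (pow_le_pow_right₀ hY1 ?_)
      have : (r + 1) * e₁ ≤ (c + 1) * e₁ := Nat.mul_le_mul_right _ (by omega)
      omega
    · refine le_trans ?_ (hn3.trans (le_max_left _ _))
      have := nearestIntDist_nonneg (ξ * (⌊f n⌋ : ℝ))
      gcongr
      exact le_self_pow₀ hY1 (by omega)

/-- For every pseudo-polynomial `f` there exist `η > 0`, `C > 0`
and `N₀` such that for all real `ξ` and `N ≥ N₀`,
`min_{1 ≤ n ≤ N} ‖ξ⌊f(n)⌋‖ ≤ C·N^{-η}`. -/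
theorem stmt_2 (f : ℝ → ℝ) (hf : IsPseudoPoly f) :
    ∃ (η C : ℝ) (N₀ : ℕ), 0 < η ∧ 0 < C ∧
      ∀ (ξ : ℝ) (N : ℕ), N₀ ≤ N →
        ∃ n : ℕ, 1 ≤ n ∧ n ≤ N ∧
          nearestIntDist (ξ * (⌊f (n : ℝ)⌋ : ℝ)) ≤ C * (N : ℝ) ^ (-η) := by
  obtain ⟨e, C, Y₀, hY₀, hmain⟩ := exists_floor_close hf
  have he : (0 : ℝ) < ((e + 1 : ℕ) : ℝ) := by positivity
  refine ⟨1 / ((e + 1 : ℕ) : ℝ), max C 1, ⌈Y₀ ^ (e + 1)⌉₊, by positivity, by positivity,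
    fun ξ N hN => ?_⟩
  have hNR : Y₀ ^ (e + 1) ≤ N := (Nat.le_ceil _).trans (by exact_mod_cast hN)
  have hN0 : (0 : ℝ) ≤ N := Nat.cast_nonneg N
  set Y : ℝ := (N : ℝ) ^ (1 / ((e + 1 : ℕ) : ℝ)) with hY
  have hYpow : Y ^ (e + 1) = N := by
    rw [hY, ← Real.rpow_natCast, ← Real.rpow_mul hN0, one_div_mul_cancel he.ne', Real.rpow_one]
  have hYY₀ : Y₀ ≤ Y := by
    rw [← hYpow] at hNR
    exact le_of_pow_le_pow_left₀ (by omega) (by positivity) hNR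
  have hY0 : 0 < Y := by linarith
  obtain ⟨n, hn1, hn2, hn3⟩ := hmain Y ξ hYY₀
  refine ⟨n, hn1, ?_, ?_⟩
  · have : (n : ℝ) ≤ N := by
      rw [← hYpow]
      exact hn2.trans (pow_le_pow_right₀ (by linarith) (by omega))
    exact_mod_cast this
  · rw [Real.rpow_neg hN0, ← hY, ← div_eq_mul_inv, le_div_iff₀ hY0]
    exact hn3.trans (le_max_left _ _)
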